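/- arXiv:2102.08017 — 2 statements merged into one kernel-verified Lean document; each statement's English description precedes it below -/
import Mathlib

section
/- Let Ω be a funnel-shaped domain, and let u_∞ be a C²(Ω̄) solution of Δu_∞ + f(u_∞) = 0 in Ω̄ with ν·∇u_∞ = 0 on ∂Ω and 0 < u_∞ ≤ 1 in Ω̄. If liminf_{x ∈ Ω̄, x₁ → +∞} u_∞(x) > θ, then u_∞ ≡ 1 in Ω̄. -/
open Set Filter Topology MeasureTheory

noncomputable section

/-- `ℝ^N` with `N = d+1`, Euclidean structure. -/
abbrev Euc (d : ℕ) := EuclideanSpace ℝ (Fin (d + 1))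

/-- The Euclidean norm of `x' = (x₂,…,x_N)` for `x = (x₁,x') ∈ ℝ^N`. -/
def primeNorm {d : ℕ} (x : Euc d) : ℝ :=
  Real.sqrt (∑ i, if i = 0 then 0 else (x i) ^ 2)

/-- The funnel-shaped domain `Ω = {x : |x'| < h(x₁)}`. -/
def funnel (d : ℕ) (h : ℝ → ℝ) : Set (Euc d) := {x | primeNorm x < h (x 0)}

/-- The Laplacian of `g` at `x`, computed with derivatives taken within the set `s`. -/
def lapW {d : ℕ} (s : Set (Euc d)) (g : Euc d → ℝ) (x : Euc d) : ℝ :=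
  ∑ i, fderivWithin ℝ (fun y => fderivWithin ℝ g s y (EuclideanSpace.single i 1)) s x
      (EuclideanSpace.single i 1)

/-- The quantity `ν·∇g` at a boundary point `x` of the funnel domain `Ω_{R,α}`, where
`ν(x) = (1+h'(x₁)²)^{-1/2}·(-h'(x₁), x'/|x'|)` is the outward unit normal. -/
def neumannLHS {d : ℕ} (h : ℝ → ℝ) (g : Euc d → ℝ) (x : Euc d) : ℝ :=
  (Real.sqrt (1 + deriv h (x 0) ^ 2))⁻¹ *
    (-(deriv h (x 0)) * fderivWithin ℝ g (closure (funnel d h)) x (EuclideanSpace.single 0 1)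
      + ∑ i, if i = 0 then 0 else
          (x i / primeNorm x) *
            fderivWithin ℝ g (closure (funnel d h)) x (EuclideanSpace.single i 1))

/-- The bistable nonlinearity `f`, of class `C^{1,1}`, with positive mass, extended affinely
outside `[0,1]`. -/
structure Bistable (f : ℝ → ℝ) (θ : ℝ) : Prop where
  smooth : ContDiff ℝ 1 f
  lip_deriv : ∃ C : NNReal, LipschitzWith C (deriv f)
  f0 : f 0 = 0
  f1 : f 1 = 0
  df0 : deriv f 0 < 0
  df1 : deriv f 1 < 0
  θmem : θ ∈ Ioo (0 : ℝ) 1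
  neg : ∀ s ∈ Ioo (0 : ℝ) θ, f s < 0
  pos : ∀ s ∈ Ioo θ (1 : ℝ), 0 < f s
  dθ : 0 < deriv f θ
  mass : 0 < ∫ s in (0 : ℝ)..1, f s
  ext_neg : ∀ s < (0 : ℝ), f s = deriv f 0 * s
  ext_pos : ∀ s > (1 : ℝ), f s = deriv f 1 * (s - 1)

/-- The planar traveling front `φ(x₁ - ct)`: `φ'' + cφ' + f(φ) = 0`, `φ(-∞) = 1`,
`φ(+∞) = 0`, `0 < φ < 1`, `φ` decreasing, normalized by `φ(0) = θ`, with speed `c > 0`. -/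
structure PlanarFront (f : ℝ → ℝ) (θ c : ℝ) (φ : ℝ → ℝ) : Prop where
  cpos : 0 < c
  mem : ∀ z : ℝ, φ z ∈ Ioo (0 : ℝ) 1
  smooth : ContDiff ℝ 2 φ
  anti : StrictAnti φ
  ode : ∀ z : ℝ, deriv (deriv φ) z + c * deriv φ z + f (φ z) = 0
  lim_bot : Tendsto φ atBot (nhds 1)
  lim_top : Tendsto φ atTop (nhds 0)
  pin : φ 0 = θ

/-- `h : ℝ → ℝ` defines a funnel-shaped domain `Ω_{R,α}` (of dimension `N = d+1 ≥ 2`) with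
cylinder radius `R`, opening angle `α` and transition parameter `L`. -/
structure IsFunnel (d : ℕ) (R α L : ℝ) (h : ℝ → ℝ) : Prop where
  dpos : 1 ≤ d
  Rpos : 0 < R
  αmem : α ∈ Ico (0 : ℝ) (Real.pi / 2)
  RL : R < L
  smooth : ContDiff ℝ 2 h
  holder : ∃ β : NNReal, 0 < β ∧ (β : ℝ) < 1 ∧ ∃ C : NNReal, HolderWith C β (deriv (deriv h))
  deriv_nonneg : ∀ x : ℝ, 0 ≤ deriv h x
  deriv_le : ∀ x : ℝ, deriv h x ≤ Real.tan α
  left : ∀ x ≤ (0 : ℝ), h x = R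
  right : ∀ x : ℝ, L * Real.cos α ≤ x → h x = x * Real.tan α

/-- An entire solution of `u_t = Δu + f(u)` in `ℝ × Ω̄` (with values in `[0,1]`),
Neumann boundary condition `ν·∇u = 0` on `ℝ × ∂Ω`, emanating from the planar front
`φ(x₁ - ct)` as `t → -∞`. -/
structure IsEntireSolution (d : ℕ) (h f : ℝ → ℝ) (c : ℝ) (φ : ℝ → ℝ)
    (u : ℝ → Euc d → ℝ) : Prop where
  range01 : ∀ t : ℝ, ∀ x ∈ closure (funnel d h), u t x ∈ Icc (0 : ℝ) 1
  time_diff : ∀ x ∈ closure (funnel d h), Differentiable ℝ fun t => u t x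
  space_reg : ∀ t : ℝ, ContDiffOn ℝ 2 (u t) (closure (funnel d h))
  pde : ∀ t : ℝ, ∀ x ∈ closure (funnel d h),
      deriv (fun s => u s x) t = lapW (closure (funnel d h)) (u t) x + f (u t x)
  neumann : ∀ t : ℝ, ∀ x ∈ frontier (funnel d h), neumannLHS h (u t) x = 0
  past : ∀ ε > (0 : ℝ), ∃ T : ℝ, ∀ t ≤ T, ∀ x ∈ closure (funnel d h),
      |u t x - φ (x 0 - c * t)| ≤ ε

/-- Complete propagation: `u(t,x) → 1` as `t → +∞` locally uniformly in `x ∈ Ω̄`. -/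
def CompletePropagation (d : ℕ) (h : ℝ → ℝ) (u : ℝ → Euc d → ℝ) : Prop :=
  TendstoLocallyUniformlyOn u (fun _ => (1 : ℝ)) atTop (closure (funnel d h))

/-- Blocking: `u(t,·)` converges uniformly on `Ω̄`, as `t → +∞`, to a stationary solution
`u_∞` with `u_∞(x) → 0` as `x₁ → +∞`. -/
def Blocked (d : ℕ) (h f : ℝ → ℝ) (u : ℝ → Euc d → ℝ) : Prop :=
  ∃ uinf : Euc d → ℝ,
    TendstoUniformlyOn u uinf atTop (closure (funnel d h)) ∧
    ContDiffOn ℝ 2 uinf (closure (funnel d h)) ∧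
    (∀ x ∈ closure (funnel d h), lapW (closure (funnel d h)) uinf x + f (uinf x) = 0) ∧
    (∀ x ∈ frontier (funnel d h), neumannLHS h uinf x = 0) ∧
    (∀ ε > (0 : ℝ), ∃ A : ℝ, ∀ x ∈ closure (funnel d h), A ≤ x 0 → |uinf x| ≤ ε)

/-- Stability of a solution `U` of `ΔU + f(U) = 0` on `s̄`:
`∫_s (|∇ψ|² - f'(U)ψ²) ≥ 0` for all compactly supported `C¹` functions `ψ`. -/
def StableOn {d : ℕ} (s : Set (Euc d)) (f : ℝ → ℝ) (U : Euc d → ℝ) : Prop :=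
  ∀ ψ : Euc d → ℝ, ContDiff ℝ 1 ψ → HasCompactSupport ψ →
    0 ≤ ∫ x in s, (‖gradient ψ x‖ ^ 2 - deriv f (U x) * ψ x ^ 2)

section LocalMin

variable {E : Type*} [NormedAddCommGroup E] [NormedSpace ℝ E]

/-- A second-order necessary condition for one-sided minima along a ray. -/
lemma IsLocalMinOn.ray_second_order {S : Set E} {z : E} {J : E → ℝ} {J' : E → E →L[ℝ] ℝ}
    {J'' : E →L[ℝ] E →L[ℝ] ℝ} (hz : z ∈ S) (hmin : IsLocalMinOn J S z)
    (hJ : ∀ᶠ x in 𝓝[S] z, HasFDerivWithinAt J (J' x) S x)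
    (hJ' : HasFDerivWithinAt J' J'' S z) {v : E}
    (hv : ∀ᶠ t : ℝ in 𝓝[>] 0, z + t • v ∈ S) :
    0 ≤ J' z v ∧ (J' z v = 0 → 0 ≤ J'' v v) := by
  have hcurve : Tendsto (fun t : ℝ => z + t • v) (𝓝[>] 0) (𝓝[S] z) := by
    refine tendsto_nhdsWithin_iff.2 ⟨?_, hv⟩
    have : Continuous fun t : ℝ => z + t • v := by fun_prop
    simpa using (this.tendsto 0).mono_left nhdsWithin_le_nhds
  have hev := hv.and ((hcurve.eventually hJ).and (hcurve.eventually hmin))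
  obtain ⟨ε, hε, hall⟩ := (mem_nhdsGT_iff_exists_Ioo_subset).1 hev
  have hε0 : (0 : ℝ) < ε := hε
  have hmem : ∀ t ∈ Ico (0 : ℝ) ε, z + t • v ∈ S := by
    intro t ht
    rcases ht.1.eq_or_lt with h0 | h0
    · simpa [← h0] using hz
    · exact (hall ⟨h0, ht.2⟩).1
  have hline : ∀ t : ℝ, HasDerivAt (fun t : ℝ => z + t • v) v t := fun t => by
    simpa using ((hasDerivAt_id t).smul_const v).const_add z
  have hJz : HasFDerivWithinAt J (J' z) S z := hJ.self_of_nhdsWithin hz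
  have hder : ∀ t ∈ Ico (0 : ℝ) ε,
      HasDerivWithinAt (fun t : ℝ => J (z + t • v)) (J' (z + t • v) v) (Ico 0 ε) t := by
    intro t ht
    have hx : HasFDerivWithinAt J (J' (z + t • v)) S (z + t • v) := by
      rcases ht.1.eq_or_lt with h0 | h0
      · simpa [← h0] using hJz
      · exact (hall ⟨h0, ht.2⟩).2.1
    exact hx.comp_hasDerivWithinAt t (hline t).hasDerivWithinAt hmem
  have hder' : HasDerivWithinAt (fun t : ℝ => J' (z + t • v) v) (J'' v v) (Ico 0 ε) 0 := by
    have h1 : HasFDerivWithinAt J' J'' S (z + (0 : ℝ) • v) := by simpa using hJ'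
    have h2 := h1.comp_hasDerivWithinAt (0 : ℝ) (hline 0).hasDerivWithinAt hmem
    have h3 := ((ContinuousLinearMap.apply ℝ ℝ v).hasFDerivAt
      (x := J' (z + (0 : ℝ) • v))).comp_hasDerivWithinAt (0 : ℝ) h2
    simpa [Function.comp_def] using h3
  have key : ¬ ∀ᶠ t : ℝ in 𝓝[>] 0, J' (z + t • v) v < 0 := by
    intro hneg
    obtain ⟨δ, hδ, hsub⟩ := (mem_nhdsGT_iff_exists_Ioo_subset).1 hneg
    have hδ0 : (0 : ℝ) < δ := hδ
    obtain ⟨s, hs0, hs⟩ := exists_between (lt_min hε0 hδ0)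
    obtain ⟨hsε, hsδ⟩ := lt_min_iff.1 hs
    have hsubI : Icc 0 s ⊆ Ico 0 ε := fun t ht => ⟨ht.1, ht.2.trans_lt hsε⟩
    obtain ⟨ξ, hξ, hslope⟩ := exists_hasDerivAt_eq_slope (fun t : ℝ => J (z + t • v))
      (fun t => J' (z + t • v) v) hs0
      (fun t ht => ((hder t (hsubI ht)).continuousWithinAt).mono hsubI)
      (fun t ht => (hder t ⟨ht.1.le, ht.2.trans hsε⟩).hasDerivAt
        (Ico_mem_nhds ht.1 (ht.2.trans hsε)))
    have h1 : J' (z + ξ • v) v < 0 := hsub ⟨hξ.1, hξ.2.trans hsδ⟩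
    have h2 : J z ≤ J (z + s • v) := (hall ⟨hs0, hsε⟩).2.2
    rw [hslope] at h1
    simp only [zero_smul, add_zero, sub_zero] at h1
    exact absurd h1 (not_lt.2 (div_nonneg (sub_nonneg.2 h2) hs0.le))
  have hIoo : 𝓝[>] (0 : ℝ) ≤ 𝓝[Ico 0 ε] 0 := by
    rw [nhdsWithin_Ico_eq_nhdsGE hε0]
    exact nhdsWithin_mono _ Ioi_subset_Ici_self
  refine ⟨?_, fun hzero => ?_⟩
  · by_contra hlt
    have := hder'.continuousWithinAt.tendsto
    simp only [zero_smul, add_zero] at this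
    exact key ((this.mono_left hIoo).eventually_lt_const (not_le.1 hlt))
  · by_contra hlt
    have hsl := hasDerivWithinAt_iff_tendsto_slope.1 hder'
    have hle : 𝓝[>] (0 : ℝ) ≤ 𝓝[Ico 0 ε \ {0}] 0 := by
      rw [← nhdsWithin_Ioo_eq_nhdsGT hε0]
      exact nhdsWithin_mono _ fun t ht => ⟨⟨ht.1.le, ht.2⟩, ht.1.ne'⟩
    refine key ?_
    filter_upwards [(hsl.mono_left hle).eventually_lt_const (not_le.1 hlt),
      self_mem_nhdsWithin] with t ht ht0
    have ht0' : (0 : ℝ) < t := ht0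
    simp only [slope_def_field, zero_smul, add_zero, hzero, sub_zero] at ht
    exact (div_neg_iff.1 ht).resolve_left (fun h => absurd h.2 (not_lt.2 ht0'.le)) |>.1

/-- At a local minimum relative to a set which contains, to first order, an open half-space
`{n < 0}`, the derivative vanishes and the second derivative is nonnegative, provided the
derivative in an outward direction `N` is nonnegative. -/
lemma IsLocalMinOn.second_order_of_half_space {S : Set E} {z : E} {J : E → ℝ}
    {J' : E → E →L[ℝ] ℝ} {J'' : E →L[ℝ] E →L[ℝ] ℝ} (hz : z ∈ S) (hmin : IsLocalMinOn J S z)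
    (hJ : ∀ᶠ x in 𝓝[S] z, HasFDerivWithinAt J (J' x) S x)
    (hJ' : HasFDerivWithinAt J' J'' S z) {n : E →L[ℝ] ℝ} {N : E} (hN : 0 < n N)
    (hin : ∀ v, n v < 0 → ∀ᶠ t : ℝ in 𝓝[>] 0, z + t • v ∈ S) (hJN : 0 ≤ J' z N) :
    J' z = 0 ∧ ∀ v, 0 ≤ J'' v v := by
  have hray := fun v hv => hmin.ray_second_order hz hJ hJ' (hin v hv)
  have hN0 : J' z N = 0 := by
    have := (hray (-N) (by simpa using hN)).1
    rw [map_neg] at this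
    linarith
  have hnn : ∀ v, 0 ≤ J' z v := by
    intro v
    have hneg : n (v - ((|n v| + 1) / n N) • N) < 0 := by
      simp only [map_sub, map_smul, smul_eq_mul]
      rw [div_mul_cancel₀ _ hN.ne']
      have := le_abs_self (n v)
      linarith
    simpa [hN0] using (hray _ hneg).1
  have hzero : J' z = 0 := by
    ext v
    refine le_antisymm ?_ (hnn v)
    simpa using hnn (-v)
  refine ⟨hzero, ?_⟩
  have hle : ∀ v, n v ≤ 0 → 0 ≤ J'' v v := by
    intro v hv
    have hcont : Continuous fun t : ℝ => J'' (v - t • N) (v - t • N) := by fun_prop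
    have hlim : Tendsto (fun t : ℝ => J'' (v - t • N) (v - t • N)) (𝓝[>] 0) (𝓝 (J'' v v)) := by
      simpa using (hcont.tendsto 0).mono_left nhdsWithin_le_nhds
    refine ge_of_tendsto hlim ?_
    filter_upwards [self_mem_nhdsWithin] with t ht
    have ht0 : (0 : ℝ) < t := ht
    refine (hray _ ?_).2 (by simp [hzero])
    have := mul_pos ht0 hN
    simp only [map_sub, map_smul, smul_eq_mul]
    linarith
  intro v
  rcases le_total (n v) 0 with hv | hv
  · exact hle v hv
  · simpa using hle (-v) (by simpa using hv)

/-- A set which contains, to first order, an open half-space at `z` has unique derivatives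
at `z`. -/
lemma uniqueDiffWithinAt_of_half_space {S : Set E} {z : E} (hz : z ∈ S) {n : E →L[ℝ] ℝ} {N : E}
    (hN : 0 < n N) (hin : ∀ v, n v < 0 → ∀ᶠ t : ℝ in 𝓝[>] 0, z + t • v ∈ S) :
    UniqueDiffWithinAt ℝ S z := by
  have hcone : ∀ v, n v < 0 → v ∈ tangentConeAt ℝ S z := by
    intro v hv
    refine mem_tangentConeAt_of_add_smul_mem (l := 𝓝[>] (0 : ℝ)) (c := fun t => t) ?_ ?_
    · exact nhdsWithin_mono _ fun t (ht : (0 : ℝ) < t) => ht.ne'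
    · exact hin v hv
  have hspan : Submodule.span ℝ (tangentConeAt ℝ S z) = ⊤ := by
    refine eq_top_iff.2 fun v _ => ?_
    set c := (|n v| + 1) / n N with hc
    have hc0 : 0 < c := by positivity
    have h1 : v - c • N ∈ Submodule.span ℝ (tangentConeAt ℝ S z) := by
      refine Submodule.subset_span (hcone _ ?_)
      simp only [map_sub, map_smul, smul_eq_mul, hc]
      rw [div_mul_cancel₀ _ hN.ne']
      have := le_abs_self (n v)
      linarith
    have h2 : -N ∈ Submodule.span ℝ (tangentConeAt ℝ S z) :=
      Submodule.subset_span (hcone _ (by simpa using hN))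
    have := Submodule.sub_mem _ h1 (Submodule.smul_mem _ c h2)
    simpa using this
  exact ⟨by rw [hspan]; exact dense_univ, subset_closure hz⟩

end LocalMin

section Nonlinearity

variable {f : ℝ → ℝ} {θ : ℝ}

lemma Bistable.integral_to_one_pos (hf : Bistable f θ) {s : ℝ} (hs : s ∈ Ico (0 : ℝ) 1) :
    0 < ∫ t in s..1, f t := by
  have hint : ∀ a b : ℝ, IntervalIntegrable f volume a b :=
    fun a b => hf.smooth.continuous.intervalIntegrable a b
  rcases lt_or_ge s θ with h | h
  · have h1 : ∫ t in (0 : ℝ)..s, f t ≤ 0 := by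
      have : 0 ≤ ∫ t in (0 : ℝ)..s, -f t := by
        refine intervalIntegral.integral_nonneg hs.1 fun t ht => ?_
        rcases ht.1.eq_or_lt with h0 | h0
        · simp [← h0, hf.f0]
        · exact neg_nonneg.2 (hf.neg t ⟨h0, ht.2.trans_lt h⟩).le
      rw [intervalIntegral.integral_neg] at this
      linarith
    have := intervalIntegral.integral_add_adjacent_intervals (hint 0 s) (hint s 1)
    have := hf.mass
    linarith
  · exact intervalIntegral.intervalIntegral_pos_of_pos_on (hint s 1)
      (fun t ht => hf.pos t ⟨h.trans_lt ht.1, ht.2⟩) hs.2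

/-- For levels `b` close to `1`, the shifted potential `∫ₛᵇ (f - f b)` is positive below `b`. -/
lemma Bistable.eventually_potential_pos (hf : Bistable f θ) :
    ∀ᶠ b in 𝓝[<] (1 : ℝ), ∀ s ∈ Ico (0 : ℝ) b, 0 < ∫ t in s..b, (f t - f b) := by
  have hc := hf.smooth.continuous
  have hint : ∀ a b : ℝ, IntervalIntegrable f volume a b := fun a b => hc.intervalIntegrable a b
  have hdc : Continuous (deriv f) := hf.smooth.continuous_deriv le_rfl
  obtain ⟨a, ha1, ha⟩ := (mem_nhdsLT_iff_exists_Ioo_subset' (zero_lt_one' ℝ)).1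
    ((hdc.tendsto 1).mono_left nhdsWithin_le_nhds |>.eventually_lt_const hf.df1)
  have ha1' : a < 1 := ha1
  have hanti : StrictAntiOn f (Icc (max a 0) 1) := by
    refine strictAntiOn_of_deriv_neg (convex_Icc _ _) hc.continuousOn fun x hx => ?_
    rw [interior_Icc] at hx
    exact ha ⟨(le_max_left _ _).trans_lt hx.1, hx.2⟩
  set e := max a 0 with he
  have he0 : 0 ≤ e := le_max_right _ _
  have he1 : e < 1 := max_lt ha1' one_pos
  have hFc : Continuous fun s : ℝ => ∫ t in s..1, f t := by
    have : (fun s : ℝ => ∫ t in s..1, f t) = fun s => -∫ t in (1 : ℝ)..s, f t := by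
      funext s; rw [intervalIntegral.integral_symm]
    rw [this]
    exact (intervalIntegral.continuous_primitive hint 1).neg
  obtain ⟨s₀, hs₀, hmin⟩ := isCompact_Icc.exists_isMinOn (nonempty_Icc.2 he0) hFc.continuousOn
  have hc0 : 0 < ∫ t in s₀..1, f t := hf.integral_to_one_pos ⟨hs₀.1, hs₀.2.trans_lt he1⟩
  have hlim : Tendsto (fun b : ℝ => (∫ t in b..1, f t) + f b) (𝓝[<] 1) (𝓝 0) := by
    have := ((hFc.add hc).tendsto 1).mono_left (nhdsWithin_le_nhds (s := Iio 1))
    simpa [hf.f1, Pi.add_def] using this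
  have hθ := hf.θmem
  filter_upwards [hlim.eventually_lt_const hc0,
    Ioo_mem_nhdsLT (max_lt he1 hθ.2)] with b hb hbI s hs
  have hbe : e < b := (le_max_left _ _).trans_lt hbI.1
  have hbθ : θ < b := (le_max_right _ _).trans_lt hbI.1
  have hb1 : b < 1 := hbI.2
  rcases le_or_gt s e with h | h
  · rw [intervalIntegral.integral_sub (hint _ _) intervalIntegrable_const,
      intervalIntegral.integral_const, smul_eq_mul]
    have h1 := intervalIntegral.integral_add_adjacent_intervals (hint s b) (hint b 1)
    have h2 : (∫ t in s₀..1, f t) ≤ ∫ t in s..1, f t := hmin ⟨hs.1, h⟩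
    have h3 := hf.pos b ⟨hbθ, hb1⟩
    have h4 : (b - s) * f b ≤ 1 * f b :=
      mul_le_mul_of_nonneg_right (by linarith [hs.1]) h3.le
    linarith
  · refine intervalIntegral.intervalIntegral_pos_of_pos_on
      ((hint _ _).sub intervalIntegrable_const) (fun t ht => ?_) hs.2
    exact sub_pos.2 (hanti ⟨(h.trans ht.1).le, (ht.2.trans hb1).le⟩ ⟨hbe.le, hb1.le⟩ ht.2)

/-- The inverse profile of a strict one-dimensional subsolution increasing to `b`: a primitive
`X` of a positive function `p` on `(0, b)`, bounded below and blowing up at `b`, with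
`p' = (f - f b) p ^ 3`. -/
lemma Bistable.exists_inverse_profile (hf : Bistable f θ) {b : ℝ} (hb : b ∈ Ioo (0 : ℝ) 1)
    (hpos : ∀ s ∈ Ico (0 : ℝ) b, 0 < ∫ t in s..b, (f t - f b)) :
    ∃ X p : ℝ → ℝ, (∀ s ∈ Ioo 0 b, 0 < p s) ∧ (∀ s ∈ Ioo 0 b, HasDerivAt X (p s) s) ∧
      (∀ s ∈ Ioo 0 b, HasDerivAt p ((f s - f b) * p s ^ 3) s) ∧
      (∀ s ∈ Ioo 0 b, 0 ≤ X s) ∧ ∀ C : ℝ, ∃ σ ∈ Ioo 0 b, C < X σ := by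
  have hc := hf.smooth.continuous
  have hgc : Continuous fun t => f t - f b := by fun_prop
  set G : ℝ → ℝ := fun s => ∫ t in s..b, (f t - f b) with hG
  have hGd : ∀ s, HasDerivAt G (-(f s - f b)) s := fun s =>
    intervalIntegral.integral_hasDerivAt_left (hgc.intervalIntegrable _ _)
      hgc.stronglyMeasurable.stronglyMeasurableAtFilter hgc.continuousAt
  have hGc : Continuous G := continuous_iff_continuousAt.2 fun s => (hGd s).continuousAt
  set p : ℝ → ℝ := fun s => (√(2 * G s))⁻¹ with hp
  have hpp : ∀ s ∈ Ico 0 b, 0 < p s := fun s hs =>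
    inv_pos.2 (Real.sqrt_pos.2 (by have := hpos s hs; positivity))
  have hpc : ∀ s ∈ Ico 0 b, ContinuousAt p s := fun s hs =>
    ContinuousAt.inv₀ (by fun_prop) (inv_pos.1 (hpp s hs)).ne'
  have hpm : Measurable p := (Real.continuous_sqrt.measurable.comp
    (hGc.measurable.const_mul 2)).inv
  have hpi : ∀ s ∈ Ico 0 b, IntervalIntegrable p volume 0 s := fun s hs =>
    ContinuousOn.intervalIntegrable fun t ht => by
      rw [uIcc_of_le hs.1] at ht
      exact (hpc t ⟨ht.1, ht.2.trans_lt hs.2⟩).continuousWithinAt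
  have hXd : ∀ s ∈ Ioo 0 b, HasDerivAt (fun s => ∫ t in (0 : ℝ)..s, p t) (p s) s := fun s hs =>
    intervalIntegral.integral_hasDerivAt_right (hpi s ⟨hs.1.le, hs.2⟩)
      hpm.stronglyMeasurable.stronglyMeasurableAtFilter (hpc s ⟨hs.1.le, hs.2⟩)
  refine ⟨fun s => ∫ t in (0 : ℝ)..s, p t, p, fun s hs => hpp s ⟨hs.1.le, hs.2⟩, hXd, ?_, ?_, ?_⟩
  · intro s hs
    have hGs : 0 < 2 * G s := by have := hpos s ⟨hs.1.le, hs.2⟩; positivity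
    have hsq := Real.sqrt_pos.2 hGs
    have h1 := (((hGd s).const_mul 2).sqrt hGs.ne').inv hsq.ne'
    refine HasDerivAt.congr_deriv h1 ?_
    change _ = (f s - f b) * (√(2 * G s))⁻¹ ^ 3
    field_simp
  · intro s hs
    exact intervalIntegral.integral_nonneg hs.1.le fun t ht =>
      (hpp t ⟨ht.1, ht.2.trans_lt hs.2⟩).le
  · obtain ⟨K, hK⟩ := hf.smooth.contDiffOn.exists_lipschitzOnWith (s := Icc (0 : ℝ) 1) (by simp)
      (convex_Icc _ _) isCompact_Icc
    set M : ℝ := K + 1 with hM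
    have hM0 : 0 < M := by positivity
    have hGle : ∀ s ∈ Ico 0 b, 2 * G s ≤ 2 * M * (b - s) ^ 2 := by
      intro s hs
      have hle : G s ≤ ∫ _ in s..b, M * (b - s) := by
        refine intervalIntegral.integral_mono_on hs.2.le (hgc.intervalIntegrable _ _)
          intervalIntegrable_const fun t ht => ?_
        have h1 := hK.dist_le_mul t ⟨hs.1.trans ht.1, ht.2.trans hb.2.le⟩ b ⟨hb.1.le, hb.2.le⟩
        rw [Real.dist_eq, Real.dist_eq, abs_sub_comm t b, abs_of_nonneg (sub_nonneg.2 ht.2)] at h1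
        have h2 : (K : ℝ) * (b - t) ≤ M * (b - s) :=
          mul_le_mul (by linarith) (by linarith [ht.1]) (by linarith [ht.2]) hM0.le
        exact (le_abs_self _).trans (h1.trans h2)
      rw [intervalIntegral.integral_const, smul_eq_mul] at hle
      nlinarith
    have hple : ∀ s ∈ Ico 0 b, (√(2 * M))⁻¹ * (b - s)⁻¹ ≤ p s := by
      intro s hs
      have h1 := hpos s hs
      rw [← mul_inv]
      refine inv_anti₀ (Real.sqrt_pos.2 (by positivity)) ?_
      rw [← Real.sqrt_sq (sub_nonneg.2 hs.2.le), ← Real.sqrt_mul (by positivity)]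
      exact Real.sqrt_le_sqrt (hGle s hs)
    intro C
    set k := (√(2 * M))⁻¹ with hk
    have hk0 : 0 < k := inv_pos.2 (Real.sqrt_pos.2 (by positivity))
    have hlow : ∀ s ∈ Ioo 0 b, k * (Real.log b - Real.log (b - s)) ≤ ∫ t in (0 : ℝ)..s, p t := by
      intro s hs
      have hd : ∀ t ∈ uIcc 0 s,
          HasDerivAt (fun t => -(k * Real.log (b - t))) (k * (b - t)⁻¹) t := by
        intro t ht
        rw [uIcc_of_le hs.1.le] at ht
        have hbt : b - t ≠ 0 := by linarith [ht.2, hs.2]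
        have := ((((hasDerivAt_id t).const_sub b).log hbt).const_mul k).neg
        refine HasDerivAt.congr_deriv this ?_
        simp only [id]
        ring
      have hci : IntervalIntegrable (fun t => k * (b - t)⁻¹) volume 0 s := by
        refine ContinuousOn.intervalIntegrable ?_
        rw [uIcc_of_le hs.1.le]
        refine continuousOn_const.mul (ContinuousOn.inv₀ (by fun_prop) fun t ht => ?_)
        linarith [ht.2, hs.2]
      have h1 := intervalIntegral.integral_eq_sub_of_hasDerivAt hd hci
      have h2 := intervalIntegral.integral_mono_on hs.1.le hci (hpi s ⟨hs.1.le, hs.2⟩)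
        fun t ht => hple t ⟨ht.1, ht.2.trans_lt hs.2⟩
      rw [h1, sub_zero] at h2
      linarith
    have hlim : Tendsto (fun s => k * (Real.log b - Real.log (b - s))) (𝓝[<] b) atTop := by
      refine Tendsto.const_mul_atTop hk0 ?_
      have h1 : Tendsto (fun s => b - s) (𝓝[<] b) (𝓝[>] 0) := by
        refine tendsto_nhdsWithin_iff.2 ⟨?_, ?_⟩
        · have : Continuous fun s : ℝ => b - s := by fun_prop
          simpa using (this.tendsto b).mono_left (nhdsWithin_le_nhds (s := Iio b))
        · filter_upwards [self_mem_nhdsWithin] with s hs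
          exact sub_pos.2 (mem_Iio.1 hs)
      have h2 := Real.tendsto_log_nhdsGT_zero.comp h1
      simpa [sub_eq_add_neg, Function.comp_def] using
        tendsto_atTop_add_const_left _ (Real.log b) (tendsto_neg_atBot_atTop.comp h2)
    obtain ⟨σ, hσ, hσI⟩ := ((hlim.eventually_gt_atTop C).and (Ioo_mem_nhdsLT hb.1)).exists
    exact ⟨σ, hσI, hσ.trans_le (hlow σ hσI)⟩

end Nonlinearity

section Geometry

variable {d : ℕ} {h : ℝ → ℝ} {R α L : ℝ}

/-- The projection `(x₁, x') ↦ (0, x')`. -/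
def crossProj (d : ℕ) : Euc d →L[ℝ] Euc d :=
  ContinuousLinearMap.id ℝ (Euc d) -
    (EuclideanSpace.proj (0 : Fin (d + 1)) : Euc d →L[ℝ] ℝ).smulRight (EuclideanSpace.single 0 1)

lemma crossProj_apply (x : Euc d) (i : Fin (d + 1)) :
    crossProj d x i = if i = 0 then 0 else x i := by
  by_cases hi : i = 0
  · subst hi; simp [crossProj]
  · simp [crossProj, hi]

lemma primeNorm_eq_norm (x : Euc d) : primeNorm x = ‖crossProj d x‖ := by
  rw [primeNorm, EuclideanSpace.norm_eq]
  congr 1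
  refine Finset.sum_congr rfl fun i _ => ?_
  rw [crossProj_apply]
  split_ifs <;> simp

lemma inner_crossProj_crossProj (x y : Euc d) :
    inner ℝ (crossProj d x) (crossProj d y) = inner ℝ (crossProj d x) y := by
  simp only [PiLp.inner_apply, crossProj_apply]
  refine Finset.sum_congr rfl fun i _ => ?_
  split_ifs <;> simp

/-- The (non-normalized) outward normal `(-h'(x₁), x'/|x'|)`. -/
def outwardNormal (h : ℝ → ℝ) (x : Euc d) : Euc d :=
  (primeNorm x)⁻¹ • crossProj d x - deriv h (x 0) • EuclideanSpace.single 0 1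

lemma outwardNormal_zero (x : Euc d) : outwardNormal h x 0 = -deriv h (x 0) := by
  simp [outwardNormal, crossProj_apply]

lemma inner_outwardNormal (x v : Euc d) : inner ℝ (outwardNormal h x) v =
    (primeNorm x)⁻¹ * inner ℝ (crossProj d x) (crossProj d v) - deriv h (x 0) * v 0 := by
  rw [inner_crossProj_crossProj, outwardNormal, inner_sub_left, real_inner_smul_left,
    real_inner_smul_left, EuclideanSpace.inner_single_left]
  simp

lemma neumannLHS_eq (g : Euc d → ℝ) (x : Euc d) :
    neumannLHS h g x = (√(1 + deriv h (x 0) ^ 2))⁻¹ *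
      fderivWithin ℝ g (closure (funnel d h)) x (outwardNormal h x) := by
  rw [neumannLHS]
  congr 1
  set ℓ := fderivWithin ℝ g (closure (funnel d h)) x
  have hsum : crossProj d x =
      ∑ i, (if i = 0 then 0 else x i) • EuclideanSpace.single i (1 : ℝ) := by
    ext j
    simp only [crossProj_apply, WithLp.ofLp_sum, Finset.sum_apply, PiLp.smul_apply,
      PiLp.single_apply, smul_eq_mul, mul_ite, mul_one, mul_zero, Finset.sum_ite_eq,
      Finset.mem_univ, if_true]
  rw [outwardNormal, map_sub, map_smul, map_smul, hsum, map_sum, smul_eq_mul, smul_eq_mul,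
    Finset.mul_sum, neg_mul, neg_add_eq_sub]
  congr 1
  refine Finset.sum_congr rfl fun i _ => ?_
  rw [map_smul, smul_eq_mul]
  split_ifs <;> ring

lemma IsFunnel.differentiable (hΩ : IsFunnel d R α L h) : Differentiable ℝ h :=
  hΩ.smooth.differentiable (by norm_num)

lemma IsFunnel.monotone (hΩ : IsFunnel d R α L h) : Monotone h :=
  monotone_of_deriv_nonneg hΩ.differentiable hΩ.deriv_nonneg

lemma IsFunnel.pos (hΩ : IsFunnel d R α L h) (x : ℝ) : 0 < h x := by
  have h1 := hΩ.monotone (min_le_left x 0)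
  rw [hΩ.left _ (min_le_right x 0)] at h1
  exact hΩ.Rpos.trans_le h1

lemma continuous_primeNorm : Continuous (primeNorm : Euc d → ℝ) := by
  rw [show (primeNorm : Euc d → ℝ) = fun x => ‖crossProj d x‖ from funext primeNorm_eq_norm]
  fun_prop

lemma continuous_coord (i : Fin (d + 1)) : Continuous fun x : Euc d => x i :=
  (EuclideanSpace.proj i : Euc d →L[ℝ] ℝ).continuous

lemma IsFunnel.isOpen (hΩ : IsFunnel d R α L h) : IsOpen (funnel d h) :=
  isOpen_lt continuous_primeNorm (hΩ.differentiable.continuous.comp (continuous_coord 0))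

lemma IsFunnel.primeNorm_le (hΩ : IsFunnel d R α L h) {x : Euc d}
    (hx : x ∈ closure (funnel d h)) : primeNorm x ≤ h (x 0) :=
  closure_lt_subset_le continuous_primeNorm
    (hΩ.differentiable.continuous.comp (continuous_coord 0)) hx

lemma IsFunnel.primeNorm_eq (hΩ : IsFunnel d R α L h) {x : Euc d}
    (hx : x ∈ frontier (funnel d h)) : primeNorm x = h (x 0) := by
  rw [hΩ.isOpen.frontier_eq] at hx
  exact le_antisymm (hΩ.primeNorm_le hx.1) (not_lt.1 hx.2)

lemma IsFunnel.inner_outwardNormal_self_pos (hΩ : IsFunnel d R α L h) {x : Euc d}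
    (hx : x ∈ frontier (funnel d h)) :
    0 < inner ℝ (outwardNormal h x) (outwardNormal h x) := by
  have hp : 0 < primeNorm x := hΩ.primeNorm_eq hx ▸ hΩ.pos _
  rw [real_inner_self_pos]
  intro h0
  have h1 := inner_outwardNormal (h := h) x (crossProj d x)
  rw [h0, inner_zero_left, inner_crossProj_crossProj, crossProj_apply, real_inner_self_eq_norm_sq,
    ← primeNorm_eq_norm] at h1
  have : (primeNorm x)⁻¹ * primeNorm x ^ 2 = primeNorm x := by field_simp
  simp only [this, if_true, mul_zero, sub_zero] at h1
  exact hp.ne h1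

/-- Rays pointing strictly inward at a boundary point enter the funnel. -/
lemma IsFunnel.eventually_mem_of_inward (hΩ : IsFunnel d R α L h) {z v : Euc d}
    (hz : z ∈ frontier (funnel d h)) (hv : inner ℝ (outwardNormal h z) v < 0) :
    ∀ᶠ t : ℝ in 𝓝[>] 0, z + t • v ∈ funnel d h := by
  have hp := hΩ.primeNorm_eq hz
  have hp0 : 0 < primeNorm z := hp ▸ hΩ.pos _
  have hd1 : HasDerivAt (fun t : ℝ => h (z 0 + t * v 0)) (deriv h (z 0) * v 0) 0 := by
    have h1 : HasDerivAt (fun t : ℝ => z 0 + t * v 0) (v 0) 0 := by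
      simpa using ((hasDerivAt_id (0 : ℝ)).mul_const (v 0)).const_add (z 0)
    have h2 : HasDerivAt h (deriv h (z 0)) (z 0 + 0 * v 0) := by
      simpa using (hΩ.differentiable (z 0)).hasDerivAt
    exact h2.comp 0 h1
  have hd2 : HasDerivAt (fun t : ℝ => crossProj d z + t • crossProj d v) (crossProj d v) 0 := by
    simpa using ((hasDerivAt_id (0 : ℝ)).smul_const (crossProj d v)).const_add (crossProj d z)
  have hd := (hd1.pow 2).sub hd2.norm_sq
  have hpos : (0 : ℝ) < 2 * h (z 0) * (deriv h (z 0) * v 0) -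
      2 * inner ℝ (crossProj d z) (crossProj d v) := by
    rw [inner_outwardNormal] at hv
    have h1 : inner ℝ (crossProj d z) (crossProj d v) < primeNorm z * (deriv h (z 0) * v 0) := by
      rw [← div_lt_iff₀' hp0, div_eq_inv_mul]
      linarith
    rw [hp] at h1
    linarith
  have hsl := (hasDerivAt_iff_tendsto_slope.1 hd).mono_left
    (nhdsWithin_mono (0 : ℝ) fun t (ht : (0 : ℝ) < t) => ht.ne')
  have hev := hsl.eventually_const_lt (u := 0) (by simpa using hpos)
  filter_upwards [hev, self_mem_nhdsWithin] with t ht ht0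
  have ht0' : (0 : ℝ) < t := ht0
  have hpz : ‖crossProj d z‖ = h (z 0) := by rw [← primeNorm_eq_norm, hp]
  simp only [slope_def_field, Pi.sub_apply, Pi.pow_apply, zero_smul, zero_mul, add_zero, hpz,
    sub_self, sub_zero] at ht
  have hnum := (div_pos_iff_of_pos_right ht0').1 ht
  change primeNorm (z + t • v) < h ((z + t • v) 0)
  rw [primeNorm_eq_norm, map_add, map_smul]
  refine lt_of_pow_lt_pow_left₀ 2 (hΩ.pos _).le ?_
  simpa using hnum

lemma IsFunnel.eventually_mem_of_interior (hΩ : IsFunnel d R α L h) {z : Euc d}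
    (hz : z ∈ funnel d h) (v : Euc d) : ∀ᶠ t : ℝ in 𝓝[>] 0, z + t • v ∈ funnel d h := by
  have hc : Continuous fun t : ℝ => z + t • v := by fun_prop
  have := (hc.tendsto 0).mono_left (nhdsWithin_le_nhds (s := Ioi 0))
  exact this.eventually (by simpa using hΩ.isOpen.mem_nhds hz)

lemma IsFunnel.mem_funnel_or_frontier (hΩ : IsFunnel d R α L h) {z : Euc d}
    (hz : z ∈ closure (funnel d h)) : z ∈ funnel d h ∨ z ∈ frontier (funnel d h) := by
  rw [hΩ.isOpen.frontier_eq]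
  by_cases hm : z ∈ funnel d h
  · exact Or.inl hm
  · exact Or.inr ⟨hz, hm⟩

lemma IsFunnel.uniqueDiffOn (hΩ : IsFunnel d R α L h) :
    UniqueDiffOn ℝ (closure (funnel d h)) := by
  intro z hz
  rcases hΩ.mem_funnel_or_frontier hz with hm | hm
  · exact uniqueDiffWithinAt_of_mem_nhds
      (mem_of_superset (hΩ.isOpen.mem_nhds hm) subset_closure)
  · exact uniqueDiffWithinAt_of_half_space hz (n := innerSL ℝ (outwardNormal h z))
      (N := outwardNormal h z) (hΩ.inner_outwardNormal_self_pos hm)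
      fun v hv => (hΩ.eventually_mem_of_inward hm hv).mono fun t ht => subset_closure ht

/-- Second-order necessary condition at a minimum on the closed funnel, when the outward normal
derivative is nonnegative in case the minimum is attained on the boundary. -/
lemma IsFunnel.second_order_of_isLocalMinOn (hΩ : IsFunnel d R α L h) {z : Euc d}
    {J : Euc d → ℝ} {J' : Euc d → Euc d →L[ℝ] ℝ} {J'' : Euc d →L[ℝ] Euc d →L[ℝ] ℝ}
    (hz : z ∈ closure (funnel d h)) (hmin : IsLocalMinOn J (closure (funnel d h)) z)
    (hJ : ∀ᶠ x in 𝓝[closure (funnel d h)] z, HasFDerivWithinAt J (J' x) (closure (funnel d h)) x)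
    (hJ' : HasFDerivWithinAt J' J'' (closure (funnel d h)) z)
    (hN : z ∈ frontier (funnel d h) → 0 ≤ J' z (outwardNormal h z)) :
    J' z = 0 ∧ ∀ v, 0 ≤ J'' v v := by
  rcases hΩ.mem_funnel_or_frontier hz with hm | hm
  · have hin : ∀ v, ∀ᶠ t : ℝ in 𝓝[>] 0, z + t • v ∈ closure (funnel d h) := fun v =>
      (hΩ.eventually_mem_of_interior hm v).mono fun t ht => subset_closure ht
    have hray := fun v => hmin.ray_second_order hz hJ hJ' (hin v)
    have hzero : J' z = 0 := by
      ext v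
      refine le_antisymm ?_ (hray v).1
      simpa using (hray (-v)).1
    exact ⟨hzero, fun v => (hray v).2 (by simp [hzero])⟩
  · exact hmin.second_order_of_half_space hz hJ hJ' (n := innerSL ℝ (outwardNormal h z))
      (hΩ.inner_outwardNormal_self_pos hm)
      (fun v hv => (hΩ.eventually_mem_of_inward hm hv).mono fun t ht => subset_closure ht) (hN hm)

lemma IsFunnel.isCompact_slab (hΩ : IsFunnel d R α L h) (a b : ℝ) :
    IsCompact (closure (funnel d h) ∩ {x | a ≤ x 0 ∧ x 0 ≤ b}) := by
  refine Metric.isCompact_of_isClosed_isBounded ?_ ?_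
  · exact isClosed_closure.inter ((isClosed_le continuous_const (continuous_coord 0)).inter
      (isClosed_le (continuous_coord 0) continuous_const))
  · refine isBounded_iff_forall_norm_le.2 ⟨h b + (|a| + |b|), fun x hx => ?_⟩
    have h1 : ‖crossProj d x‖ ≤ h b := by
      rw [← primeNorm_eq_norm]
      exact (hΩ.primeNorm_le hx.1).trans (hΩ.monotone hx.2.2)
    have h2 : x = crossProj d x + x 0 • EuclideanSpace.single 0 1 := by
      simp [crossProj]
    have h3 : ‖x 0 • (EuclideanSpace.single 0 1 : Euc d)‖ ≤ |a| + |b| := by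
      rw [norm_smul, PiLp.norm_single, norm_one, mul_one, Real.norm_eq_abs]
      refine abs_le.2 ⟨?_, ?_⟩
      · linarith [hx.2.1, neg_abs_le a, abs_nonneg b]
      · linarith [hx.2.2, le_abs_self b, abs_nonneg a]
    calc ‖x‖ = ‖crossProj d x + x 0 • EuclideanSpace.single 0 1‖ := by rw [← h2]
      _ ≤ _ := (norm_add_le _ _).trans (add_le_add h1 h3)

/-- In the conical part, the outward normal at `z` makes a nonnegative angle with `z - y` for
every point `y` of the closed conical part. -/
lemma IsFunnel.inner_outwardNormal_sub_nonneg (hΩ : IsFunnel d R α L h) {z y : Euc d}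
    (hz : z ∈ frontier (funnel d h)) (hy : y ∈ closure (funnel d h))
    (hzL : L * Real.cos α < z 0) (hyL : L * Real.cos α ≤ y 0) :
    0 ≤ inner ℝ (outwardNormal h z) (z - y) := by
  have hp := hΩ.primeNorm_eq hz
  have hp0 : 0 < primeNorm z := hp ▸ hΩ.pos _
  have hd : deriv h (z 0) = Real.tan α := by
    have : h =ᶠ[𝓝 (z 0)] fun x => x * Real.tan α := by
      filter_upwards [lt_mem_nhds hzL] with x hx
      exact hΩ.right x hx.le
    rw [this.deriv_eq]
    simp
  have hy' := hΩ.primeNorm_le hy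
  rw [hΩ.right _ hyL] at hy'
  have hz' : primeNorm z = z 0 * Real.tan α := by rw [hp, hΩ.right _ hzL.le]
  have hcs : inner ℝ (crossProj d z) (crossProj d y) ≤ primeNorm z * primeNorm y := by
    rw [primeNorm_eq_norm, primeNorm_eq_norm]
    exact real_inner_le_norm _ _
  have h1 : (primeNorm z)⁻¹ * inner ℝ (crossProj d z) (crossProj d y) ≤ primeNorm y := by
    rw [← div_eq_inv_mul, div_le_iff₀' hp0]
    exact hcs
  have h2 : (primeNorm z)⁻¹ * inner ℝ (crossProj d z) (crossProj d z) = primeNorm z := by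
    rw [real_inner_self_eq_norm_sq, ← primeNorm_eq_norm]
    field_simp
  rw [inner_outwardNormal, map_sub, inner_sub_right, mul_sub, h2, hd, PiLp.sub_apply]
  nlinarith

lemma hasFDerivWithinAt_fderivWithin_of_contDiffOn {s : Set (Euc d)} {g : Euc d → ℝ}
    (hs : UniqueDiffOn ℝ s) (hg : ContDiffOn ℝ 2 g s) {x : Euc d} (hx : x ∈ s) :
    HasFDerivWithinAt (fderivWithin ℝ g s) (fderivWithin ℝ (fderivWithin ℝ g s) s x) s x :=
  (((hg.fderivWithin hs (m := 1) (by norm_num)).differentiableOn (by norm_num)) x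
    hx).hasFDerivWithinAt

lemma lapW_eq_sum {s : Set (Euc d)} {g : Euc d → ℝ} (hs : UniqueDiffOn ℝ s)
    (hg : ContDiffOn ℝ 2 g s) {x : Euc d} (hx : x ∈ s) :
    lapW s g x = ∑ i, fderivWithin ℝ (fderivWithin ℝ g s) s x (EuclideanSpace.single i 1)
      (EuclideanSpace.single i 1) := by
  refine Finset.sum_congr rfl fun i _ => ?_
  have h1 := (hasFDerivWithinAt_fderivWithin_of_contDiffOn hs hg hx).clm_apply
    (hasFDerivWithinAt_const (EuclideanSpace.single i (1 : ℝ)) x s)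
  rw [h1.fderivWithin (hs x hx)]
  simp

end Geometry

section Comparison

variable {d : ℕ} {f h : ℝ → ℝ} {θ R α L : ℝ}

lemma fderivWithin_outwardNormal_eq_zero {g : Euc d → ℝ} {x : Euc d}
    (hx : neumannLHS h g x = 0) :
    fderivWithin ℝ g (closure (funnel d h)) x (outwardNormal h x) = 0 := by
  rw [neumannLHS_eq] at hx
  exact (mul_eq_zero.1 hx).resolve_left (inv_ne_zero (Real.sqrt_pos.2 (by positivity)).ne')

/-- A solution that stays above some `m > θ` as `x₁ → +∞` is eventually above any `b < 1`. -/
lemma IsFunnel.exists_forall_le_of_liminf (hΩ : IsFunnel d R α L h) (hf : Bistable f θ)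
    {u : Euc d → ℝ} (hreg : ContDiffOn ℝ 2 u (closure (funnel d h)))
    (hrange : ∀ x ∈ closure (funnel d h), u x ∈ Ioc (0 : ℝ) 1)
    (hpde : ∀ x ∈ closure (funnel d h), lapW (closure (funnel d h)) u x + f (u x) = 0)
    (hneu : ∀ x ∈ frontier (funnel d h), neumannLHS h u x = 0) {m A : ℝ} (hm : θ < m)
    (hA : ∀ x ∈ closure (funnel d h), A ≤ x 0 → m ≤ u x) {b : ℝ} (hb : b < 1) :
    ∃ B : ℝ, ∀ x ∈ closure (funnel d h), B ≤ x 0 → b ≤ u x := by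
  rcases lt_or_ge b m with hbm | hmb
  · exact ⟨A, fun x hx hAx => hbm.le.trans (hA x hx hAx)⟩
  set S := closure (funnel d h) with hS
  obtain ⟨s₀, hs₀, hmin⟩ := isCompact_Icc.exists_isMinOn (nonempty_Icc.2 hmb)
    hf.smooth.continuous.continuousOn
  set κ := f s₀ with hκ
  have hκ0 : 0 < κ := hf.pos s₀ ⟨hm.trans_le hs₀.1, hs₀.2.trans_lt hb⟩
  set ε := κ / (4 * ((d : ℝ) + 1)) with hε
  have hε0 : 0 < ε := by positivity
  set r := √(1 / ε) with hr
  have hr0 : 0 < r := Real.sqrt_pos.2 (by positivity)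
  have hεr : ε * r ^ 2 = 1 := by
    rw [hr, Real.sq_sqrt (by positivity)]
    field_simp
  refine ⟨max A (L * Real.cos α) + r, fun y hy hBy => ?_⟩
  by_contra! hlt
  have hyA : A ≤ y 0 - r := by linarith [le_max_left A (L * Real.cos α)]
  have hyL : L * Real.cos α ≤ y 0 - r := by linarith [le_max_right A (L * Real.cos α)]
  set J : Euc d → ℝ := fun x => u x + ε * ‖x - y‖ ^ 2 with hJdef
  have hJc : ContinuousOn J S := hreg.continuousOn.add (by fun_prop)
  obtain ⟨z, hzK, hzmin⟩ := ((isCompact_closedBall y r).inter_left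
    (isClosed_closure (s := funnel d h))).exists_isMinOn
    ⟨y, hy, Metric.mem_closedBall_self hr0.le⟩ (hJc.mono inter_subset_left)
  have hzS : z ∈ S := hzK.1
  have hJz : J z ≤ J y := hzmin ⟨hy, Metric.mem_closedBall_self hr0.le⟩
  have hJy : J y = u y := by simp [hJdef]
  have hzr : ‖z - y‖ < r := by
    have hle : ‖z - y‖ ≤ r := by simpa [dist_eq_norm] using hzK.2
    refine hle.lt_of_ne fun heq => ?_
    have h1 : J z = u z + 1 := by simp only [hJdef, heq, hεr]
    linarith [(hrange z hzS).1, (hrange y hy).2]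
  have hz0 : y 0 - r < z 0 := by
    have h1 : |(z - y) 0| ≤ ‖z - y‖ := by
      simpa using PiLp.norm_apply_le (z - y) 0
    rw [PiLp.sub_apply] at h1
    linarith [neg_abs_le (z 0 - y 0)]
  have hlocal : IsLocalMinOn J S z := by
    have hball : Metric.ball y r ∈ 𝓝 z :=
      Metric.isOpen_ball.mem_nhds (by simpa [dist_eq_norm] using hzr)
    filter_upwards [self_mem_nhdsWithin, mem_nhdsWithin_of_mem_nhds hball] with x hx hxb
    exact hzmin ⟨hx, Metric.ball_subset_closedBall hxb⟩
  have hD : ∀ x ∈ S, HasFDerivWithinAt J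
      (fderivWithin ℝ u S x + (2 * ε) • innerSL ℝ (x - y)) S x := by
    intro x hx
    have h1 := (hreg.differentiableOn (by norm_num) x hx).hasFDerivWithinAt
    have h2 := (((hasFDerivAt_id x).sub_const y).norm_sq.const_mul ε).hasFDerivWithinAt (s := S)
    refine (h1.add h2).congr_fderiv ?_
    ext v
    simp
    ring
  let I : Euc d →L[ℝ] Euc d →L[ℝ] ℝ := innerSL ℝ
  have hD2 : HasFDerivWithinAt (fun x => fderivWithin ℝ u S x + (2 * ε) • innerSL ℝ (x - y))
      (fderivWithin ℝ (fderivWithin ℝ u S) S z + (2 * ε) • I) S z := by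
    have h1 := hasFDerivWithinAt_fderivWithin_of_contDiffOn hΩ.uniqueDiffOn hreg hzS
    have h2 : HasFDerivWithinAt (fun x : Euc d => (2 * ε) • innerSL ℝ (x - y))
        ((2 * ε) • I) S z := by
      have := ((I.hasFDerivAt (x := z - y)).comp z
        ((hasFDerivAt_id z).sub_const y)).const_smul (2 * ε)
      exact this.hasFDerivWithinAt
    exact h1.add h2
  obtain ⟨-, hpsd⟩ := hΩ.second_order_of_isLocalMinOn hzS hlocal
    (by filter_upwards [self_mem_nhdsWithin] with x hx using hD x hx) hD2 (fun hzf => by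
      have h1 := hΩ.inner_outwardNormal_sub_nonneg hzf hy (hyL.trans_lt hz0) (by linarith)
      have h2 := fderivWithin_outwardNormal_eq_zero (hneu z hzf)
      rw [real_inner_comm] at h1
      simp only [add_apply, smul_apply, innerSL_apply_apply,
        smul_eq_mul]
      rw [hS, h2, zero_add]
      positivity)
  have hI : ∀ i, I (EuclideanSpace.single i 1) (EuclideanSpace.single i 1) = 1 := fun i => by
    change inner ℝ (EuclideanSpace.single i (1 : ℝ)) (EuclideanSpace.single i (1 : ℝ)) = (1 : ℝ)
    simp
  have hsum : 0 ≤ lapW S u z + ((d : ℝ) + 1) * (2 * ε) := by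
    rw [lapW_eq_sum hΩ.uniqueDiffOn hreg hzS]
    have := Finset.sum_nonneg fun i (_ : i ∈ Finset.univ) =>
      hpsd (EuclideanSpace.single i (1 : ℝ))
    simpa [hI, Finset.sum_add_distrib] using this
  have hfz : κ ≤ f (u z) := by
    refine hmin ⟨hA z hzS (hyA.trans hz0.le), ?_⟩
    have : u z ≤ J z := by simp only [hJdef]; nlinarith [sq_nonneg ‖z - y‖]
    linarith
  have hκε : ((d : ℝ) + 1) * (2 * ε) = κ / 2 := by
    rw [hε]; field_simp; norm_num
  linarith [hpde z hzS]

/-- Sliding argument: a solution that lies above the level `b` for large `x₁` lies above `b`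
everywhere, as soon as the shifted potential is positive below `b`. -/
lemma IsFunnel.le_of_forall_le_right (hΩ : IsFunnel d R α L h) (hf : Bistable f θ)
    {u : Euc d → ℝ} (hreg : ContDiffOn ℝ 2 u (closure (funnel d h)))
    (hrange : ∀ x ∈ closure (funnel d h), 0 < u x)
    (hpde : ∀ x ∈ closure (funnel d h), lapW (closure (funnel d h)) u x + f (u x) = 0)
    (hneu : ∀ x ∈ frontier (funnel d h), neumannLHS h u x = 0) {b B : ℝ}
    (hb : b ∈ Ioo (0 : ℝ) 1) (hfb : 0 < f b)
    (hpos : ∀ s ∈ Ico (0 : ℝ) b, 0 < ∫ t in s..b, (f t - f b))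
    (hB : ∀ x ∈ closure (funnel d h), B ≤ x 0 → b ≤ u x) :
    ∀ x ∈ closure (funnel d h), b ≤ u x := by
  intro y hy
  by_contra! hlt
  set S := closure (funnel d h) with hS
  obtain ⟨X, p, hp, hX, hp', hX0, hXtop⟩ := hf.exists_inverse_profile hb hpos
  have hright : ∀ x ∈ S, u x < b → x 0 < B := fun x hx hxb =>
    lt_of_not_ge fun hge => absurd (hB x hx hge) (not_le.2 hxb)
  have hXmono : StrictMonoOn X (Ioo 0 b) := by
    refine strictMonoOn_of_deriv_pos (convex_Ioo _ _)
      (fun s hs => (hX s hs).continuousAt.continuousWithinAt) fun s hs => ?_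
    rw [interior_Ioo] at hs
    rw [(hX s hs).deriv]
    exact hp s hs
  set J : Euc d → ℝ := fun x => X (u x) - x 0 with hJdef
  obtain ⟨σ, hσ, hσX⟩ := hXtop (J y + B)
  have hyσ : u y < σ := by
    refine (hXmono.lt_iff_lt ⟨hrange y hy, hlt⟩ hσ).1 ?_
    have h1 : J y = X (u y) - y 0 := rfl
    linarith [hright y hy hlt]
  set a := -J y - 1 with ha
  have hya : a ≤ y 0 := by
    have h1 : J y = X (u y) - y 0 := rfl
    linarith [hX0 (u y) ⟨hrange y hy, hlt⟩]
  set K := (S ∩ {x | a ≤ x 0 ∧ x 0 ≤ B}) ∩ u ⁻¹' Iic σ with hK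
  have hslab := hΩ.isCompact_slab a B
  have hKc : IsCompact K := hslab.of_isClosed_subset
    ((hreg.continuousOn.mono inter_subset_left).preimage_isClosed_of_isClosed hslab.isClosed
      isClosed_Iic) inter_subset_left
  have hlevel : ∀ x ∈ S, u x ≤ σ → u x ∈ Ioo 0 b := fun x hx hxσ =>
    ⟨hrange x hx, hxσ.trans_lt hσ.2⟩
  have hJc : ContinuousOn J K := by
    refine ContinuousOn.sub (fun x hx => ?_) (continuous_coord 0).continuousOn
    exact (hX _ (hlevel x hx.1.1 hx.2)).continuousAt.comp_continuousWithinAt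
      ((hreg.continuousOn x hx.1.1).mono fun w hw => hw.1.1)
  have hyK : y ∈ K := ⟨⟨hy, hya, (hright y hy hlt).le⟩, hyσ.le⟩
  obtain ⟨z, hzK, hzmin⟩ := hKc.exists_isMinOn ⟨y, hyK⟩ hJc
  have hzS : z ∈ S := hzK.1.1
  have hzb : u z ∈ Ioo 0 b := hlevel z hzS hzK.2
  have hJzy : J z ≤ J y := hzmin hyK
  have hzσ : u z < σ := by
    refine (hXmono.lt_iff_lt hzb hσ).1 ?_
    have h1 : J z = X (u z) - z 0 := rfl
    linarith [hright z hzS hzb.2]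
  have hnear : ∀ᶠ x in 𝓝[S] z, x ∈ S ∧ u x < σ :=
    (eventually_mem_nhdsWithin).and ((hreg.continuousOn z hzS).tendsto.eventually_lt_const hzσ)
  have hlocal : IsLocalMinOn J S z := by
    filter_upwards [hnear] with x hx
    have hxb := hlevel x hx.1 hx.2.le
    rcases le_or_gt a (x 0) with hax | hax
    · exact hzmin ⟨⟨hx.1, hax, (hright x hx.1 hxb.2).le⟩, hx.2.le⟩
    · have h1 : J x = X (u x) - x 0 := rfl
      linarith [hX0 _ hxb]
  set π₀ : Euc d →L[ℝ] ℝ := EuclideanSpace.proj (0 : Fin (d + 1)) with hπ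
  have hdu : ∀ x ∈ S, HasFDerivWithinAt u (fderivWithin ℝ u S x) S x := fun x hx =>
    (hreg.differentiableOn (by norm_num) x hx).hasFDerivWithinAt
  have hD : ∀ᶠ x in 𝓝[S] z,
      HasFDerivWithinAt J (p (u x) • fderivWithin ℝ u S x - π₀) S x := by
    filter_upwards [hnear] with x hx
    have h1 := (hX _ (hlevel x hx.1 hx.2.le)).comp_hasFDerivWithinAt x (hdu x hx.1)
    exact h1.sub π₀.hasFDerivAt.hasFDerivWithinAt
  have hD2 := (((hp' _ hzb).comp_hasFDerivWithinAt z (hdu z hzS)).smul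
    (hasFDerivWithinAt_fderivWithin_of_contDiffOn hΩ.uniqueDiffOn hreg hzS)).sub_const π₀
  obtain ⟨hcrit, hpsd⟩ := hΩ.second_order_of_isLocalMinOn hzS hlocal hD hD2 (fun hzf => by
    have h2 := fderivWithin_outwardNormal_eq_zero (hneu z hzf)
    have h3 : π₀ (outwardNormal h z) = -deriv h (z 0) := outwardNormal_zero z
    have h4 := hΩ.deriv_nonneg (z 0)
    change 0 ≤ p (u z) * fderivWithin ℝ u S z (outwardNormal h z) - π₀ (outwardNormal h z)
    rw [hS, h2, h3]
    linarith)
  have hpz := hp _ hzb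
  have hgrad : ∀ v, fderivWithin ℝ u S z v = (p (u z))⁻¹ * v 0 := by
    intro v
    have h1 : p (u z) * fderivWithin ℝ u S z v - v 0 = 0 := DFunLike.congr_fun hcrit v
    field_simp
    linarith
  have hsum : 0 ≤ p (u z) * lapW S u z +
      (f (u z) - f b) * p (u z) ^ 3 * (p (u z))⁻¹ ^ 2 := by
    rw [lapW_eq_sum hΩ.uniqueDiffOn hreg hzS]
    have hdir : ∀ v, 0 ≤ p (u z) * fderivWithin ℝ (fderivWithin ℝ u S) S z v v +
        (f (u z) - f b) * p (u z) ^ 3 * (p (u z))⁻¹ ^ 2 * v 0 ^ 2 := by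
      intro v
      have h1 : 0 ≤ p (u z) * fderivWithin ℝ (fderivWithin ℝ u S) S z v v +
          ((f (u z) - f b) * p (u z) ^ 3 * fderivWithin ℝ u S z v) * fderivWithin ℝ u S z v :=
        hpsd v
      rw [hgrad] at h1
      linarith
    have h1 := Finset.sum_nonneg fun i (_ : i ∈ Finset.univ) =>
      hdir (EuclideanSpace.single i (1 : ℝ))
    simpa [Finset.sum_add_distrib, ← Finset.mul_sum, PiLp.single_apply] using h1
  have hcube : (f (u z) - f b) * p (u z) ^ 3 * (p (u z))⁻¹ ^ 2 = (f (u z) - f b) * p (u z) := by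
    field_simp
  rw [hcube, show lapW S u z = -f (u z) by linarith [hpde z hzS]] at hsum
  nlinarith [mul_pos hpz hfb]

end Comparison

/-- Lemma 3.2: a stationary solution `0 < u_∞ ≤ 1` in a funnel-shaped
domain with `liminf_{x₁→+∞} u_∞ > θ` is identically `1`. -/
theorem statement10 (d : ℕ) (f h : ℝ → ℝ) (θ R α L : ℝ)
    (hf : Bistable f θ) (hΩ : IsFunnel d R α L h)
    (uinf : Euc d → ℝ)
    (hreg : ContDiffOn ℝ 2 uinf (closure (funnel d h)))
    (hrange : ∀ x ∈ closure (funnel d h), uinf x ∈ Ioc (0 : ℝ) 1)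
    (hpde : ∀ x ∈ closure (funnel d h), lapW (closure (funnel d h)) uinf x + f (uinf x) = 0)
    (hneu : ∀ x ∈ frontier (funnel d h), neumannLHS h uinf x = 0)
    (hliminf : ∃ m : ℝ, θ < m ∧ ∃ A : ℝ, ∀ x ∈ closure (funnel d h), A ≤ x 0 → m ≤ uinf x) :
    ∀ x ∈ closure (funnel d h), uinf x = 1 := by
  obtain ⟨m, hm, A, hA⟩ := hliminf
  intro x hx
  refine le_antisymm (hrange x hx).2 ?_
  have hlevels : ∀ᶠ b in 𝓝[<] (1 : ℝ), b ≤ uinf x := by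
    filter_upwards [hf.eventually_potential_pos, Ioo_mem_nhdsLT hf.θmem.2] with b hpot hb
    obtain ⟨B, hB⟩ := hΩ.exists_forall_le_of_liminf hf hreg hrange hpde hneu hm hA hb.2
    exact hΩ.le_of_forall_le_right hf hreg (fun y hy => (hrange y hy).1) hpde hneu
      ⟨hf.θmem.1.trans hb.1, hb.2⟩ (hf.pos b hb) hpot hB x hx
  exact le_of_tendsto (tendsto_id.mono_left nhdsWithin_le_nhds) hlevels
end
end

section
/- Let Ω be a funnel-shaped domain, and let u_∞ be a C²(Ω̄) solution of Δu_∞ + f(u_∞) = 0 in Ω̄ with ν·∇u_∞ = 0 on ∂Ω and 0 < u_∞ ≤ 1 in Ω̄. Let R₀ > 0 and ψ ∈ C²(B̄_{R₀}) be such that Δψ + f(ψ) = 0 in B̄_{R₀}, 0 ≤ ψ < 1, ψ = 0 on ∂B_{R₀}, ψ radially symmetric nonincreasing in |x| with ψ(0) > θ. If there exists x₀ ∈ Ω such that the closed ball B̄_{R₀}(x₀) is contained in Ω̄ and u_∞ ≥ ψ(· − x₀) on B̄_{R₀}(x₀), then u_∞ ≡ 1 in Ω̄. -/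
open Set Filter Topology MeasureTheory

noncomputable section

/-- First and second order necessary conditions at a local minimum of a real function. -/
theorem IsLocalMin.deriv_eq_zero_and_second_nonneg {φ φ' : ℝ → ℝ} {a : ℝ}
    (h1 : ∀ᶠ t in 𝓝 0, HasDerivAt φ (φ' t) t) (h2 : HasDerivAt φ' a 0)
    (hm : IsLocalMin φ 0) : φ' 0 = 0 ∧ 0 ≤ a := by
  have h0 : HasDerivAt φ (φ' 0) 0 := h1.self_of_nhds
  have hz : φ' 0 = 0 := hm.hasDerivAt_eq_zero h0
  refine ⟨hz, ?_⟩
  by_contra! ha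
  have heq : deriv φ =ᶠ[𝓝 0] φ' := h1.mono fun t ht => ht.deriv
  have hdd : deriv (deriv φ) 0 = a := by rw [heq.deriv_eq, h2.deriv]
  have hmax : IsLocalMax φ 0 :=
    isLocalMax_of_deriv_deriv_neg (by rw [hdd]; exact ha) (by rw [h0.deriv, hz]) h0.continuousAt
  have hconst : φ =ᶠ[𝓝 0] fun _ => φ 0 := by
    filter_upwards [hm, hmax] with t h3 h4 using le_antisymm h4 h3
  have hd0 : deriv φ =ᶠ[𝓝 0] fun _ => 0 := by
    simpa using hconst.deriv
  rw [hd0.deriv_eq] at hdd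
  simp at hdd
  linarith

/-- Derivatives of a `C²` function along a coordinate line through an interior point. -/
theorem hasDerivAt_coordinate_line {d : ℕ} {s : Set (Euc d)} {u : Euc d → ℝ}
    (hu : ContDiffOn ℝ 2 u s) {x : Euc d} (hx : s ∈ 𝓝 x) (i : Fin (d + 1)) :
    (∀ᶠ t in 𝓝 (0 : ℝ), HasDerivAt (fun t : ℝ => u (x + t • EuclideanSpace.single i 1))
      (fderivWithin ℝ u s (x + t • EuclideanSpace.single i 1) (EuclideanSpace.single i 1)) t) ∧
    HasDerivAt (fun t : ℝ => fderivWithin ℝ u s (x + t • EuclideanSpace.single i 1)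
        (EuclideanSpace.single i 1))
      (fderivWithin ℝ (fun y => fderivWithin ℝ u s y (EuclideanSpace.single i 1)) s x
        (EuclideanSpace.single i 1)) 0 := by
  have hline (t : ℝ) : HasDerivAt (fun t : ℝ => x + t • (EuclideanSpace.single i 1 : Euc d))
      (EuclideanSpace.single i 1) t := by
    simpa using ((hasDerivAt_id t).smul_const (EuclideanSpace.single i 1 : Euc d)).const_add x
  have htend : Tendsto (fun t : ℝ => x + t • (EuclideanSpace.single i 1 : Euc d)) (𝓝 0) (𝓝 x) := by
    simpa using (hline 0).continuousAt.tendsto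
  have hint : ∀ᶠ y in 𝓝 x, s ∈ 𝓝 y := eventually_mem_nhds_iff.2 hx
  constructor
  · filter_upwards [htend.eventually hint] with t ht
    have hd : HasFDerivAt u (fderivWithin ℝ u s (x + t • EuclideanSpace.single i 1))
        (x + t • EuclideanSpace.single i 1) := by
      rw [fderivWithin_of_mem_nhds ht]
      exact ((hu.contDiffAt ht).differentiableAt (by norm_num)).hasFDerivAt
    exact hd.comp_hasDerivAt t (hline t)
  · have hd1 : DifferentiableAt ℝ (fderiv ℝ u) x :=
      ((hu.contDiffAt hx).fderiv_right (m := 1) (by norm_num)).differentiableAt (by norm_num)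
    have hd2 : DifferentiableAt ℝ (fun y => fderivWithin ℝ u s y (EuclideanSpace.single i 1)) x := by
      refine (hd1.clm_apply (differentiableAt_const
        (EuclideanSpace.single i (1 : ℝ) : Euc d))).congr_of_eventuallyEq ?_
      filter_upwards [hint] with y hy
      rw [fderivWithin_of_mem_nhds hy]
    have hd3 := hd2.hasFDerivAt
    rw [← fderivWithin_of_mem_nhds hx] at hd3
    have h0 : x + (0 : ℝ) • (EuclideanSpace.single i 1 : Euc d) = x := by simp
    rw [← h0] at hd3
    have hd4 := hd3.comp_hasDerivAt (0 : ℝ) (hline 0)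
    rw [h0] at hd4
    exact hd4

/-- A stationary solution dominating a ball solution that vanishes on the sphere dominates it by a
margin controlled by the values of the former on the sphere. -/
theorem ball_domination_gain {d : ℕ} {f : ℝ → ℝ} {C k : ℝ}
    (hC : ∀ a ∈ Icc (0 : ℝ) 1, ∀ b ∈ Icc (0 : ℝ) 1, |f a - f b| ≤ C * |a - b|)
    (hk0 : 0 < k) (hk : C ≤ k ^ 2) {s : Set (Euc d)} {u : Euc d → ℝ}
    (hreg : ContDiffOn ℝ 2 u s) (hrange : ∀ x ∈ s, u x ∈ Ioc (0 : ℝ) 1)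
    (hpde : ∀ x ∈ s, lapW s u x + f (u x) = 0)
    {R₀ : ℝ} {ψ : Euc d → ℝ} (hψreg : ContDiffOn ℝ 2 ψ (Metric.closedBall 0 R₀))
    (hψpde : ∀ x ∈ Metric.closedBall (0 : Euc d) R₀,
      lapW (Metric.closedBall 0 R₀) ψ x + f (ψ x) = 0)
    (hψrange : ∀ x ∈ Metric.closedBall (0 : Euc d) R₀, ψ x ∈ Ico (0 : ℝ) 1)
    (hψzero : ∀ x ∈ Metric.sphere (0 : Euc d) R₀, ψ x = 0)
    {y : Euc d} (hball : Metric.closedBall y R₀ ⊆ s)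
    (hdom : ∀ x ∈ Metric.closedBall y R₀, ψ (x - y) ≤ u x)
    {m : ℝ} (hm : 0 < m) (hmu : ∀ x ∈ Metric.sphere y R₀, m ≤ u x) :
    ∀ x ∈ Metric.closedBall y R₀, ψ (x - y) + m * Real.exp (-2 * k * R₀) ≤ u x := by
  intro x hx
  set δ := m * Real.exp (-k * R₀) with hδ
  have hδ0 : 0 < δ := by positivity
  have hsub : ∀ z ∈ Metric.closedBall y R₀, z - y ∈ Metric.closedBall (0 : Euc d) R₀ := by
    intro z hz
    simpa [dist_eq_norm] using hz
  have hcoord : ∀ z ∈ Metric.closedBall y R₀, |(z - y) 0| ≤ R₀ := by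
    intro z hz
    have h1 := EuclideanSpace.norm_eq (z - y)
    have h2 : ‖(z - y) 0‖ ≤ ‖z - y‖ := PiLp.norm_apply_le _ _
    have h3 := hsub z hz
    rw [mem_closedBall_zero_iff] at h3
    rw [Real.norm_eq_abs] at h2
    linarith
  set Z : Euc d → ℝ := fun z => u z - ψ (z - y) - δ * Real.exp (k * (z - y) 0) with hZ
  have hZc : ContinuousOn Z (Metric.closedBall y R₀) := by
    refine ((hreg.continuousOn.mono hball).sub ?_).sub ?_
    · exact hψreg.continuousOn.comp (by fun_prop) hsub
    · fun_prop
  suffices hpos : ∀ z ∈ Metric.closedBall y R₀, 0 ≤ Z z by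
    have h1 := hpos x hx
    have h2 : Real.exp (-k * R₀) ≤ Real.exp (k * (x - y) 0) := by
      apply Real.exp_le_exp.2
      nlinarith [neg_le_of_abs_le (hcoord x hx)]
    have h3 : m * Real.exp (-2 * k * R₀) = δ * Real.exp (-k * R₀) := by
      rw [hδ, mul_assoc m, ← Real.exp_add]; ring_nf
    simp only [hZ] at h1
    have h4 := mul_le_mul_of_nonneg_left h2 hδ0.le
    linarith
  obtain ⟨p, hp, hpmin⟩ := (isCompact_closedBall y R₀).exists_isMinOn ⟨x, hx⟩ hZc
  suffices 0 ≤ Z p from fun z hz => this.trans (hpmin hz)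
  by_contra! hneg
  by_cases hps : p ∈ Metric.sphere y R₀
  · have h1 : ψ (p - y) = 0 := hψzero _ (by simpa [dist_eq_norm] using hps)
    have h2 : Real.exp (-k * R₀) * Real.exp (k * (p - y) 0) ≤ 1 := by
      rw [← Real.exp_add, Real.exp_le_one_iff]
      nlinarith [le_of_abs_le (hcoord p hp)]
    have h3 := hmu p hps
    simp only [hZ, h1, hδ] at hneg
    nlinarith
  have hpb : p ∈ Metric.ball y R₀ := by
    rw [Metric.mem_ball]
    exact lt_of_le_of_ne hp hps
  have hns : s ∈ 𝓝 p := mem_of_superset (Metric.isOpen_ball.mem_nhds hpb)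
    (Metric.ball_subset_closedBall.trans hball)
  have hnb : Metric.closedBall (0 : Euc d) R₀ ∈ 𝓝 (p - y) := by
    refine mem_of_superset (Metric.isOpen_ball.mem_nhds ?_) Metric.ball_subset_closedBall
    simpa [dist_eq_norm] using hpb
  have hZmin : IsLocalMin Z p := by
    filter_upwards [Metric.isOpen_ball.mem_nhds hpb] with z hz
    exact hpmin (Metric.ball_subset_closedBall hz)
  set w := Real.exp (k * (p - y) 0) with hw
  have key (i : Fin (d + 1)) :
      0 ≤ fderivWithin ℝ (fun z => fderivWithin ℝ u s z (EuclideanSpace.single i 1)) s p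
          (EuclideanSpace.single i 1) -
        fderivWithin ℝ (fun z => fderivWithin ℝ ψ (Metric.closedBall 0 R₀) z
          (EuclideanSpace.single i 1)) (Metric.closedBall 0 R₀) (p - y) (EuclideanSpace.single i 1)
        - (if i = 0 then δ * k ^ 2 * w else 0) := by
    obtain ⟨hu1, hu2⟩ := hasDerivAt_coordinate_line hreg hns i
    obtain ⟨hψ1, hψ2⟩ := hasDerivAt_coordinate_line hψreg hnb i
    set c : ℝ := if i = 0 then 1 else 0 with hc
    have hl (t : ℝ) : HasDerivAt (fun t => k * ((p - y) 0 + t * c)) (k * c) t := by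
      simpa using (((hasDerivAt_id t).mul_const c).const_add ((p - y) 0)).const_mul k
    have hE (t : ℝ) : HasDerivAt (fun t => δ * Real.exp (k * ((p - y) 0 + t * c)))
        (δ * (Real.exp (k * ((p - y) 0 + t * c)) * (k * c))) t :=
      ((hl t).exp).const_mul δ
    have hE2 := (((hl 0).exp).mul_const (k * c)).const_mul δ
    have hfun : (fun t : ℝ => Z (p + t • EuclideanSpace.single i 1)) =
        fun t => u (p + t • EuclideanSpace.single i 1) - ψ ((p - y) + t • EuclideanSpace.single i 1)
          - δ * Real.exp (k * ((p - y) 0 + t * c)) := by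
      funext t
      have e1 : p + t • (EuclideanSpace.single i 1 : Euc d) - y =
        (p - y) + t • EuclideanSpace.single i 1 := by abel
      have e2 : ((p - y) + t • (EuclideanSpace.single i 1 : Euc d)) 0 = (p - y) 0 + t * c := by
        by_cases hi : i = 0
        · subst hi; simp [hc]
        · have : (0 : Fin (d + 1)) ≠ i := fun h => hi h.symm
          simp [hc, hi, this]
      simp only [hZ, e1, e2]
    have hmin : IsLocalMin (fun t : ℝ => Z (p + t • EuclideanSpace.single i 1)) 0 := by
      have ht : Tendsto (fun t : ℝ => p + t • (EuclideanSpace.single i 1 : Euc d)) (𝓝 0) (𝓝 p) := by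
        have : Continuous (fun t : ℝ => p + t • (EuclideanSpace.single i 1 : Euc d)) := by fun_prop
        simpa using this.tendsto 0
      have := ht.eventually hZmin
      filter_upwards [this] with t h
      simpa using h
    rw [hfun] at hmin
    have := (IsLocalMin.deriv_eq_zero_and_second_nonneg
      (by filter_upwards [hu1, hψ1] with t h1 h2 using (h1.sub h2).sub (hE t))
      ((hu2.sub hψ2).sub hE2) hmin).2
    have e3 : δ * (Real.exp (k * ((p - y) 0 + 0 * c)) * (k * c) * (k * c)) =
        if i = 0 then δ * k ^ 2 * w else 0 := by
      by_cases hi : i = 0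
      · simp only [hc, hi, hw, if_true]; ring_nf
      · simp [hc, hi]
    rw [e3] at this
    exact this
  have hsum := Finset.sum_nonneg fun i (_ : i ∈ Finset.univ) => key i
  rw [Finset.sum_sub_distrib, Finset.sum_sub_distrib, Finset.sum_ite_eq' Finset.univ 0] at hsum
  simp only [Finset.mem_univ, if_true] at hsum
  have hup := hpde p (hball hp)
  have hψp := hψpde (p - y) (hsub p hp)
  unfold lapW at hup hψp
  have hd := hdom p hp
  obtain ⟨hu0, hu1⟩ := hrange p (hball hp)
  obtain ⟨hψ0, hψ1⟩ := hψrange (p - y) (hsub p hp)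
  have hlip := hC (ψ (p - y)) ⟨hψ0, hψ1.le⟩ (u p) ⟨hu0.le, hu1⟩
  rw [abs_sub_comm (ψ _), abs_of_nonneg (sub_nonneg.2 hd)] at hlip
  have h5 := le_of_abs_le hlip
  have hw0 : 0 < w := Real.exp_pos _
  have h6 : u p - ψ (p - y) < δ * w := by simp only [hZ] at hneg; linarith
  have hd' : 0 ≤ u p - ψ (p - y) := sub_nonneg.2 hd
  have h7 : C * (u p - ψ (p - y)) ≤ k ^ 2 * (u p - ψ (p - y)) :=
    mul_le_mul_of_nonneg_right hk hd'
  have h8 : k ^ 2 * (δ * w) ≤ k ^ 2 * (u p - ψ (p - y)) := by linarith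
  have := le_of_mul_le_mul_left h8 (by positivity)
  linarith

/-- Sliding a ball solution below a stationary solution along a segment of admissible centers. -/
theorem ball_domination_segment {d : ℕ} {f : ℝ → ℝ} {C : ℝ}
    (hC : ∀ a ∈ Icc (0 : ℝ) 1, ∀ b ∈ Icc (0 : ℝ) 1, |f a - f b| ≤ C * |a - b|)
    {s : Set (Euc d)} {u : Euc d → ℝ}
    (hreg : ContDiffOn ℝ 2 u s) (hrange : ∀ x ∈ s, u x ∈ Ioc (0 : ℝ) 1)
    (hpde : ∀ x ∈ s, lapW s u x + f (u x) = 0)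
    {R₀ : ℝ} (hR₀ : 0 < R₀) {ψ : Euc d → ℝ} (hψreg : ContDiffOn ℝ 2 ψ (Metric.closedBall 0 R₀))
    (hψpde : ∀ x ∈ Metric.closedBall (0 : Euc d) R₀,
      lapW (Metric.closedBall 0 R₀) ψ x + f (ψ x) = 0)
    (hψrange : ∀ x ∈ Metric.closedBall (0 : Euc d) R₀, ψ x ∈ Ico (0 : ℝ) 1)
    (hψzero : ∀ x ∈ Metric.sphere (0 : Euc d) R₀, ψ x = 0)
    {a b : Euc d} (hseg : ∀ t ∈ Icc (0 : ℝ) 1, Metric.closedBall (a + t • (b - a)) R₀ ⊆ s)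
    (hdom : ∀ x ∈ Metric.closedBall a R₀, ψ (x - a) ≤ u x) :
    ∀ x ∈ Metric.closedBall b R₀, ψ (x - b) ≤ u x := by
  obtain ⟨k, hk0, hk⟩ : ∃ k : ℝ, 0 < k ∧ C ≤ k ^ 2 :=
    ⟨|C| + 1, by positivity, by nlinarith [le_abs_self C, abs_nonneg C]⟩
  obtain ⟨m, hm0, hm⟩ : ∃ m : ℝ, 0 < m ∧ ∀ t ∈ Icc (0 : ℝ) 1,
      ∀ x ∈ Metric.closedBall (a + t • (b - a)) R₀, m ≤ u x := by
    set Q : Set (Euc d) := (fun z : ℝ × Euc d => a + z.1 • (b - a) + z.2) ''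
      (Icc (0 : ℝ) 1 ×ˢ Metric.closedBall 0 R₀) with hQ
    have hQc : IsCompact Q :=
      (isCompact_Icc.prod (isCompact_closedBall _ _)).image (by fun_prop)
    have hQm : ∀ t ∈ Icc (0 : ℝ) 1, ∀ x ∈ Metric.closedBall (a + t • (b - a)) R₀, x ∈ Q := by
      intro t ht x hx
      refine ⟨(t, x - (a + t • (b - a))), ⟨ht, ?_⟩, by simp⟩
      simpa [dist_eq_norm] using hx
    have hQs : Q ⊆ s := by
      rintro _ ⟨⟨t, v⟩, ⟨ht, hv⟩, rfl⟩
      refine hseg t ht ?_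
      simpa [dist_eq_norm] using hv
    have hne : Q.Nonempty :=
      ⟨_, hQm 0 (by simp) (a + (0 : ℝ) • (b - a)) (Metric.mem_closedBall_self hR₀.le)⟩
    obtain ⟨p, hp, hpm⟩ := hQc.exists_isMinOn hne (hreg.continuousOn.mono hQs)
    exact ⟨u p, (hrange p (hQs hp)).1, fun t ht x hx => hpm (hQm t ht x hx)⟩
  set δ := m * Real.exp (-2 * k * R₀) with hδ
  have hδ0 : 0 < δ := by positivity
  have hδm : δ ≤ m := by
    have : Real.exp (-2 * k * R₀) ≤ 1 := Real.exp_le_one_iff.2 (by nlinarith)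
    nlinarith
  have huc := (isCompact_closedBall (0 : Euc d) R₀).uniformContinuousOn_of_continuous
    hψreg.continuousOn
  obtain ⟨ε, hε0, hε⟩ := Metric.uniformContinuousOn_iff.1 huc δ hδ0
  obtain ⟨n, hn⟩ := exists_nat_gt (‖b - a‖ / min ε R₀)
  have hmin : 0 < min ε R₀ := lt_min hε0 hR₀
  have hn0 : (0 : ℝ) < n := lt_of_le_of_lt (by positivity) hn
  have hstep : ‖b - a‖ / n < min ε R₀ := by
    rw [div_lt_iff₀ hmin] at hn
    rw [div_lt_iff₀ hn0]; linarith
  have main : ∀ j : ℕ, j ≤ n →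
      ∀ x ∈ Metric.closedBall (a + ((j : ℝ) / n) • (b - a)) R₀,
        ψ (x - (a + ((j : ℝ) / n) • (b - a))) ≤ u x := by
    intro j
    induction j with
    | zero => intro _; simpa using hdom
    | succ j ih =>
      intro hj x hx
      have hmem (i : ℕ) (hi : i ≤ n) : (i : ℝ) / n ∈ Icc (0 : ℝ) 1 :=
        ⟨by positivity, div_le_one_of_le₀ (by exact_mod_cast hi) hn0.le⟩
      set z := a + ((j : ℝ) / n) • (b - a) with hz
      set z' := a + (((j + 1 : ℕ) : ℝ) / n) • (b - a) with hz'
      have hzz : ‖z' - z‖ < min ε R₀ := by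
        have : z' - z = (1 / (n : ℝ)) • (b - a) := by
          rw [hz, hz', add_sub_add_left_eq_sub, ← sub_smul]
          congr 1
          push_cast
          ring
        rw [this, norm_smul, Real.norm_eq_abs, abs_of_pos (by positivity)]
        calc _ = ‖b - a‖ / n := by ring
          _ < _ := hstep
      have hzzε := hzz.trans_le (min_le_left _ _)
      have hzzR := hzz.trans_le (min_le_right _ _)
      have hgain := ball_domination_gain hC hk0 hk hreg hrange hpde hψreg hψpde hψrange hψzero
        (hseg _ (hmem j (by omega))) (ih (by omega)) hm0
        (fun x hx => hm _ (hmem j (by omega)) x (Metric.sphere_subset_closedBall hx))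
      have hxz' : x - z' ∈ Metric.closedBall (0 : Euc d) R₀ := by
        simpa [dist_eq_norm] using hx
      have htri : ‖x - z‖ ≤ ‖x - z'‖ + ‖z' - z‖ := by
        have := norm_add_le (x - z') (z' - z)
        rwa [sub_add_sub_cancel] at this
      by_cases hxz : x ∈ Metric.closedBall z R₀
      · have h1 := hgain x hxz
        have hxz0 : x - z ∈ Metric.closedBall (0 : Euc d) R₀ := by
          simpa [dist_eq_norm] using hxz
        have h2 := hε (x - z') hxz' (x - z) hxz0 (by
          rw [dist_eq_norm, sub_sub_sub_cancel_left, norm_sub_rev]; exact hzzε)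
        rw [Real.dist_eq] at h2
        have := le_of_abs_le h2.le
        linarith
      · rw [Metric.mem_closedBall, dist_eq_norm, not_le] at hxz
        set v := x - z' with hv
        have hv0 : 0 < ‖v‖ := by linarith
        have hvR : ‖v‖ ≤ R₀ := by simpa using hxz'
        set q := (R₀ / ‖v‖) • v with hq
        have hqn : ‖q‖ = R₀ := by
          rw [hq, norm_smul, Real.norm_eq_abs, abs_of_pos (by positivity)]
          field_simp
        have hqs : q ∈ Metric.sphere (0 : Euc d) R₀ := by simpa using hqn
        have hdist : dist v q < ε := by
          have : q - v = (R₀ / ‖v‖ - 1) • v := by rw [hq, sub_smul, one_smul]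
          rw [dist_comm, dist_eq_norm, this, norm_smul, Real.norm_eq_abs, abs_of_nonneg
            (sub_nonneg.2 ((one_le_div hv0).2 hvR)), sub_mul, div_mul_cancel₀ _ hv0.ne']
          linarith
        have h2 := hε v hxz' q (Metric.sphere_subset_closedBall hqs) hdist
        rw [hψzero q hqs, Real.dist_eq, sub_zero] at h2
        have := le_of_abs_le h2.le
        have := hm _ (hmem (j + 1) hj) x hx
        linarith
  have := main n le_rfl
  rw [div_self hn0.ne', one_smul, add_sub_cancel] at this
  exact this

theorem Bistable.exists_lipschitz {f : ℝ → ℝ} {θ : ℝ} (hf : Bistable f θ) :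
    ∃ C : ℝ, 1 ≤ C ∧ ∀ a ∈ Icc (0 : ℝ) 1, ∀ b ∈ Icc (0 : ℝ) 1, |f a - f b| ≤ C * |a - b| := by
  obtain ⟨C, hC⟩ := isCompact_Icc.exists_bound_of_continuousOn
    ((hf.smooth.continuous_deriv le_rfl).continuousOn (s := Icc (0 : ℝ) 1))
  refine ⟨max C 1, le_max_right _ _, fun a ha b hb => ?_⟩
  exact (convex_Icc (0 : ℝ) 1).norm_image_sub_le_of_norm_deriv_le
    (fun x _ => (hf.smooth.differentiable (by norm_num)).differentiableAt)
    (fun x hx => (hC x hx).trans (le_max_left _ _)) hb ha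

theorem Bistable.exists_linear_lower {f : ℝ → ℝ} {θ : ℝ} (hf : Bistable f θ) {s₀ : ℝ}
    (h0 : θ < s₀) (h1 : s₀ ≤ 1) : ∃ κ : ℝ, 0 < κ ∧ ∀ s ∈ Icc s₀ 1, κ * (1 - s) ≤ f s := by
  have hd : Differentiable ℝ f := hf.smooth.differentiable (by norm_num)
  have hc : ContinuousOn (dslope f 1) (Icc s₀ 1) := by
    intro x _
    by_cases hx : x = 1
    · subst hx
      exact (continuousAt_dslope_same.2 hd.differentiableAt).continuousWithinAt
    · exact ((continuousAt_dslope_of_ne hx).2 hd.continuous.continuousAt).continuousWithinAt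
  obtain ⟨p, hp, hpm⟩ := isCompact_Icc.exists_isMaxOn ⟨1, h1, le_rfl⟩ hc
  have hform (s : ℝ) : (s - 1) * dslope f 1 s = f s := by
    have := sub_smul_dslope f 1 s
    rwa [hf.f1, sub_zero, smul_eq_mul] at this
  have hneg : dslope f 1 p < 0 := by
    rcases hp.2.eq_or_lt with h | h
    · rw [h, dslope_same]; exact hf.df1
    · have := hf.pos p ⟨h0.trans_le hp.1, h⟩
      rw [← hform p] at this
      nlinarith
  refine ⟨-dslope f 1 p, by linarith, fun s hs => ?_⟩
  have h2 : dslope f 1 s ≤ dslope f 1 p := hpm hs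
  rw [← hform s]
  nlinarith [hs.2]

theorem Bistable.exists_integral_lower {f : ℝ → ℝ} {θ : ℝ} (hf : Bistable f θ) :
    ∃ κ : ℝ, 0 < κ ∧ ∀ s ∈ Icc (0 : ℝ) 1, κ * (1 - s) ^ 2 ≤ ∫ x in s..1, f x := by
  obtain ⟨hθ0, hθ1⟩ := hf.θmem
  have hcont : Continuous f := hf.smooth.continuous
  have hint (a b : ℝ) : IntervalIntegrable f volume a b := hcont.intervalIntegrable a b
  set s₀ := (θ + 1) / 2 with hs₀
  obtain ⟨κ, hκ, hlow⟩ := hf.exists_linear_lower (s₀ := s₀) (by linarith) (by linarith)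
  have htop : ∀ s ∈ Icc s₀ 1, κ / 2 * (1 - s) ^ 2 ≤ ∫ x in s..1, f x := by
    intro s hs
    have h1 : ∫ x in s..1, κ * (1 - x) = κ / 2 * (1 - s) ^ 2 := by
      rw [intervalIntegral.integral_const_mul, intervalIntegral.integral_sub (by simp) (by simp)]
      simp
      ring
    rw [← h1]
    exact intervalIntegral.integral_mono_on hs.2 (Continuous.intervalIntegrable (by fun_prop) _ _)
      (hint _ _) fun x hx => hlow x ⟨hs.1.trans hx.1, hx.2⟩
  have hpos : ∀ x ∈ Icc θ 1, 0 ≤ f x := by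
    have hcl : IsClosed {x | 0 ≤ f x} := isClosed_le continuous_const hcont
    have : closure (Ioo θ 1) ⊆ {x | 0 ≤ f x} :=
      closure_minimal (fun x hx => (hf.pos x hx).le) hcl
    rw [closure_Ioo hθ1.ne] at this
    exact this
  have hneg : ∀ x ∈ Icc 0 θ, f x ≤ 0 := by
    have hcl : IsClosed {x | f x ≤ 0} := isClosed_le hcont continuous_const
    have : closure (Ioo 0 θ) ⊆ {x | f x ≤ 0} :=
      closure_minimal (fun x hx => (hf.neg x hx).le) hcl
    rw [closure_Ioo hθ0.ne] at this
    exact this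
  set M := ∫ x in (0 : ℝ)..1, f x with hM
  have hM0 : 0 < M := hf.mass
  have hs₀1 : 0 < (1 - s₀) := by linarith
  refine ⟨min M (κ / 2 * (1 - s₀) ^ 2), by positivity, fun s hs => ?_⟩
  have hsq : (1 - s) ^ 2 ≤ 1 := by nlinarith [hs.1, hs.2]
  have hμ1 : min M (κ / 2 * (1 - s₀) ^ 2) ≤ M := min_le_left _ _
  have hμ2 : min M (κ / 2 * (1 - s₀) ^ 2) ≤ κ / 2 * (1 - s₀) ^ 2 := min_le_right _ _
  have hμ0 : 0 < min M (κ / 2 * (1 - s₀) ^ 2) := by positivity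
  rcases le_total s θ with h | h
  · have h1 := intervalIntegral.integral_add_adjacent_intervals (hint 0 s) (hint s 1)
    have h2 : ∫ x in (0 : ℝ)..s, f x ≤ ∫ x in (0 : ℝ)..s, (0 : ℝ) :=
      intervalIntegral.integral_mono_on hs.1 (hint _ _) (by simp)
        fun x hx => hneg x ⟨hx.1, hx.2.trans h⟩
    simp only [intervalIntegral.integral_zero] at h2
    nlinarith
  rcases le_total s s₀ with h' | h'
  · have h1 := intervalIntegral.integral_add_adjacent_intervals (hint s s₀) (hint s₀ 1)
    have h2 : 0 ≤ ∫ x in s..s₀, f x :=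
      intervalIntegral.integral_nonneg h' fun x hx => hpos x ⟨h.trans hx.1, by linarith [hx.2]⟩
    have h3 := htop s₀ ⟨le_rfl, by linarith⟩
    nlinarith
  · have h3 := htop s ⟨h', hs.2⟩
    have h4 : (1 - s₀) ^ 2 ≤ 1 := by nlinarith
    have h5 : min M (κ / 2 * (1 - s₀) ^ 2) ≤ κ / 2 := by nlinarith
    exact (mul_le_mul_of_nonneg_right h5 (sq_nonneg _)).trans h3

/-- The inverse `T` of an increasing one-dimensional profile connecting `0` to `1`, whose slope
`p` as a function of the value satisfies `p p' = -(f(s) - η (1 - s))`. -/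
theorem Bistable.exists_profile {f : ℝ → ℝ} {θ : ℝ} (hf : Bistable f θ) {C : ℝ} (hC1 : 1 ≤ C)
    (hC : ∀ a ∈ Icc (0 : ℝ) 1, ∀ b ∈ Icc (0 : ℝ) 1, |f a - f b| ≤ C * |a - b|) :
    ∃ η : ℝ, 0 < η ∧ ∃ T p : ℝ → ℝ,
      (∀ s ∈ Ioo (0 : ℝ) 1, 0 < p s ∧ p s ≤ C * (1 - s) ∧ HasDerivAt T (p s)⁻¹ s ∧
        HasDerivAt p (-(f s - η * (1 - s)) / p s) s ∧ 0 ≤ T s) ∧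
      Tendsto T (𝓝[<] 1) atTop := by
  obtain ⟨η, hη, hlow⟩ := hf.exists_integral_lower
  have hcont : Continuous f := hf.smooth.continuous
  set g : ℝ → ℝ := fun s => f s - η * (1 - s) with hg
  have hgc : Continuous g := by fun_prop
  set q : ℝ → ℝ := fun s => 2 * ∫ x in s..1, g x with hq
  have hqd (s : ℝ) : HasDerivAt q (2 * (-g s)) s :=
    (intervalIntegral.integral_hasDerivAt_left (hgc.intervalIntegrable _ _)
      (hgc.stronglyMeasurableAtFilter _ _) hgc.continuousAt).const_mul 2
  have hqc : Continuous q := continuous_iff_continuousAt.2 fun s => (hqd s).continuousAt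
  have hmodel (c s : ℝ) : ∫ x in s..1, c * (1 - x) = c / 2 * (1 - s) ^ 2 := by
    rw [intervalIntegral.integral_const_mul, intervalIntegral.integral_sub (by simp) (by simp)]
    simp
    ring
  have hqpos : ∀ s ∈ Ico (0 : ℝ) 1, 0 < q s := by
    intro s hs
    have h1 : ∫ x in s..1, g x = (∫ x in s..1, f x) - η / 2 * (1 - s) ^ 2 := by
      rw [← hmodel]
      exact intervalIntegral.integral_sub (hcont.intervalIntegrable _ _)
        (Continuous.intervalIntegrable (by fun_prop) _ _)
    have h2 := hlow s ⟨hs.1, hs.2.le⟩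
    have h3 : 0 < (1 - s) ^ 2 := pow_pos (sub_pos.2 hs.2) 2
    simp only [hq, h1]
    nlinarith
  have hqle : ∀ s ∈ Icc (0 : ℝ) 1, q s ≤ (C * (1 - s)) ^ 2 := by
    intro s hs
    have h1 : ∫ x in s..1, g x ≤ ∫ x in s..1, C * (1 - x) := by
      refine intervalIntegral.integral_mono_on hs.2 (hgc.intervalIntegrable _ _)
        (Continuous.intervalIntegrable (by fun_prop) _ _) fun x hx => ?_
      have h2 := hC x ⟨hs.1.trans hx.1, hx.2⟩ 1 (by simp)
      rw [hf.f1, sub_zero, abs_sub_comm, abs_of_nonneg (sub_nonneg.2 hx.2)] at h2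
      have h3 := le_of_abs_le h2
      have h4 : 0 ≤ η * (1 - x) := mul_nonneg hη.le (sub_nonneg.2 hx.2)
      simp only [hg]
      linarith
    rw [hmodel] at h1
    have h5 : C ≤ C ^ 2 := by nlinarith
    have h6 := mul_le_mul_of_nonneg_right h5 (sq_nonneg (1 - s))
    simp only [hq]
    nlinarith
  set p : ℝ → ℝ := fun s => √(q s) with hp
  have hpc : Continuous p := hqc.sqrt
  have hppos : ∀ s ∈ Ico (0 : ℝ) 1, 0 < p s := fun s hs => Real.sqrt_pos.2 (hqpos s hs)
  have hple : ∀ s ∈ Icc (0 : ℝ) 1, p s ≤ C * (1 - s) := fun s hs =>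
    Real.sqrt_le_iff.2 ⟨mul_nonneg (by linarith) (sub_nonneg.2 hs.2), hqle s hs⟩
  set T : ℝ → ℝ := fun s => ∫ x in (0 : ℝ)..s, (p x)⁻¹ with hT
  have hTd : ∀ s ∈ Ioo (0 : ℝ) 1, HasDerivAt T (p s)⁻¹ s := by
    intro s hs
    refine intervalIntegral.integral_hasDerivAt_right ?_ ?_ ?_
    · refine ContinuousOn.intervalIntegrable ?_
      rw [uIcc_of_le hs.1.le]
      exact hpc.continuousOn.inv₀ fun x hx => (hppos x ⟨hx.1, hx.2.trans_lt hs.2⟩).ne'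
    · exact (hpc.measurable.inv.stronglyMeasurable).stronglyMeasurableAtFilter
    · exact hpc.continuousAt.inv₀ (hppos s ⟨hs.1.le, hs.2⟩).ne'
  refine ⟨η, hη, T, p, fun s hs => ⟨hppos s ⟨hs.1.le, hs.2⟩, hple s ⟨hs.1.le, hs.2.le⟩, hTd s hs,
    ?_, ?_⟩, ?_⟩
  · have h1 := (hqd s).sqrt (hqpos s ⟨hs.1.le, hs.2⟩).ne'
    have h2 : 2 * -g s / (2 * √(q s)) = -(f s - η * (1 - s)) / p s := by
      rw [mul_div_mul_left _ _ two_ne_zero]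
    rwa [h2] at h1
  · exact intervalIntegral.integral_nonneg hs.1.le fun x hx => inv_nonneg.2 (Real.sqrt_nonneg _)
  · set H : ℝ → ℝ := fun s => T s + C⁻¹ * Real.log (1 - s) with hH
    have hHd : ∀ s ∈ Ioo (0 : ℝ) 1, HasDerivAt H ((p s)⁻¹ + C⁻¹ * (-1 / (1 - s))) s := by
      intro s hs
      have h1 : HasDerivAt (fun x : ℝ => 1 - x) (-1) s := by
        simpa using (hasDerivAt_id s).const_sub 1
      exact (hTd s hs).add ((h1.log (by linarith [hs.2])).const_mul _)
    have hmono : MonotoneOn H (Ico (1 / 2) 1) := by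
      have hsub : Ico (1 / 2 : ℝ) 1 ⊆ Ioo 0 1 := fun x hx => ⟨by linarith [hx.1], hx.2⟩
      refine monotoneOn_of_hasDerivWithinAt_nonneg (convex_Ico _ _)
        (fun x hx => (hHd x (hsub hx)).continuousAt.continuousWithinAt)
        (fun x hx => (hHd x (hsub (interior_subset hx))).hasDerivWithinAt) fun x hx => ?_
      have hx' := hsub (interior_subset hx)
      have h2 := hple x ⟨hx'.1.le, hx'.2.le⟩
      have h3 := hppos x ⟨hx'.1.le, hx'.2⟩
      have h4 : (C * (1 - x))⁻¹ ≤ (p x)⁻¹ := inv_anti₀ h3 h2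
      have h5 : C⁻¹ * (-1 / (1 - x)) = -(C * (1 - x))⁻¹ := by
        rw [mul_inv]; ring
      rw [h5]; linarith
    have hlog : Tendsto (fun s : ℝ => H (1 / 2) - C⁻¹ * Real.log (1 - s)) (𝓝[<] 1) atTop := by
      have h1 : Tendsto (fun s : ℝ => 1 - s) (𝓝[<] 1) (𝓝[>] 0) := by
        refine tendsto_nhdsWithin_iff.2 ⟨?_, ?_⟩
        · have : Continuous fun s : ℝ => 1 - s := by fun_prop
          simpa using (this.tendsto 1).mono_left nhdsWithin_le_nhds
        · filter_upwards [self_mem_nhdsWithin] with s hs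
          simpa using hs
      have h2 := (Real.tendsto_log_nhdsGT_zero.comp h1).const_mul_atBot
        (inv_pos.2 (by linarith : (0 : ℝ) < C))
      exact tendsto_atTop_add_const_left _ _ (tendsto_neg_atBot_atTop.comp h2)
    refine tendsto_atTop_mono' _ ?_ hlog
    filter_upwards [Ioo_mem_nhdsLT (by norm_num : (1 / 2 : ℝ) < 1)] with s hs
    have := hmono ⟨le_rfl, by norm_num⟩ ⟨hs.1.le, hs.2⟩ hs.1.le
    simp only [hH] at this ⊢
    linarith

/-- The Laplacian inequality at an interior local minimum of `T(u) + √(A² + |· - y|²)`. -/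
theorem laplacian_ineq_of_isLocalMin {d : ℕ} {f : ℝ → ℝ} {η : ℝ} {T p : ℝ → ℝ}
    (hTp : ∀ s ∈ Ioo (0 : ℝ) 1, 0 < p s ∧ HasDerivAt T (p s)⁻¹ s ∧
        HasDerivAt p (-(f s - η * (1 - s)) / p s) s)
    {s : Set (Euc d)} {u : Euc d → ℝ} (hreg : ContDiffOn ℝ 2 u s) {x : Euc d} (hx : s ∈ 𝓝 x)
    (hux : u x ∈ Ioo (0 : ℝ) 1) (hpde : lapW s u x + f (u x) = 0) {A : ℝ} (hA : 0 < A) {y : Euc d}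
    (hmin : IsLocalMin (fun z => T (u z) + √(A ^ 2 + ‖z - y‖ ^ 2)) x) :
    0 ≤ (f (u x) - η * (1 - u x)) * (‖x - y‖ ^ 2 / (A ^ 2 + ‖x - y‖ ^ 2)) - f (u x)
      + (d + 1) * (p (u x) / A) := by
  set v := x - y with hv
  set B := A ^ 2 + ‖v‖ ^ 2 with hB
  have hB0 : 0 < B := by positivity
  set P := p (u x) with hP
  set g := f (u x) - η * (1 - u x) with hg
  obtain ⟨hP0, -, hpx⟩ := hTp _ hux
  rw [← hP] at hP0
  have key (i : Fin (d + 1)) : 0 ≤ g / B * v i ^ 2 +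
      fderivWithin ℝ (fun z => fderivWithin ℝ u s z (EuclideanSpace.single i 1)) s x
          (EuclideanSpace.single i 1) + P / A := by
    obtain ⟨hu1, hu2⟩ := hasDerivAt_coordinate_line hreg hx i
    set φ : ℝ → ℝ := fun t => u (x + t • EuclideanSpace.single i 1) with hφ
    set φ' : ℝ → ℝ := fun t =>
      fderivWithin ℝ u s (x + t • EuclideanSpace.single i 1) (EuclideanSpace.single i 1) with hφ'
    have hφ0 : φ 0 = u x := by simp [hφ]
    set b : ℝ → ℝ := fun t => B + 2 * t * v i + t ^ 2 with hb
    have hbnorm (t : ℝ) :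
        A ^ 2 + ‖x + t • (EuclideanSpace.single i 1 : Euc d) - y‖ ^ 2 = b t := by
      have e1 : x + t • (EuclideanSpace.single i 1 : Euc d) - y =
        v + t • EuclideanSpace.single i 1 := by rw [hv]; abel
      rw [e1, norm_add_sq_real, norm_smul, inner_smul_right, EuclideanSpace.inner_single_right]
      simp [hb, hB]
      ring
    have hbpos (t : ℝ) : 0 < b t := by rw [← hbnorm]; positivity
    have hb0 : b 0 = B := by simp [hb]
    have hbd (t : ℝ) : HasDerivAt b (2 * (v i + t)) t := by
      have h1 := ((((hasDerivAt_id t).const_mul 2).mul_const (v i)).const_add B).add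
        ((hasDerivAt_id t).pow 2)
      refine h1.congr_deriv ?_
      norm_num
      ring
    have hGd (t : ℝ) : HasDerivAt (fun t => √(b t)) ((v i + t) / √(b t)) t := by
      have h1 := (hbd t).sqrt (hbpos t).ne'
      rwa [mul_div_mul_left _ _ two_ne_zero] at h1
    have hlin : HasDerivAt (fun t : ℝ => v i + t) 1 0 := (hasDerivAt_id (0 : ℝ)).const_add _
    have hG2 := hlin.div (hGd 0) (Real.sqrt_pos.2 (hbpos 0)).ne'
    have hφd0 : HasDerivAt φ (φ' 0) 0 := hu1.self_of_nhds
    have hmem : ∀ᶠ t in 𝓝 (0 : ℝ), φ t ∈ Ioo (0 : ℝ) 1 :=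
      hφd0.continuousAt.eventually (isOpen_Ioo.mem_nhds (by rw [hφ0]; exact hux))
    have hd1 : ∀ᶠ t in 𝓝 (0 : ℝ), HasDerivAt (fun t => T (φ t) + √(b t))
        ((p (φ t))⁻¹ * φ' t + (v i + t) / √(b t)) t := by
      filter_upwards [hmem, hu1] with t h1 h2
      exact (((hTp _ h1).2.1).comp t h2).add (hGd t)
    rw [← hφ0] at hpx
    have hpφ := hpx.comp (0 : ℝ) hφd0
    have hpinv := hpφ.fun_inv (by simp only [Function.comp, hφ0]; exact hP0.ne')
    have hd2 := (hpinv.mul hu2).add hG2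
    have hm : IsLocalMin (fun t => T (φ t) + √(b t)) 0 := by
      have ht : Tendsto (fun t : ℝ => x + t • (EuclideanSpace.single i 1 : Euc d)) (𝓝 0) (𝓝 x) := by
        have : Continuous (fun t : ℝ => x + t • (EuclideanSpace.single i 1 : Euc d)) := by fun_prop
        simpa using this.tendsto 0
      filter_upwards [ht.eventually hmin] with t h
      rw [hbnorm t] at h
      rw [hφ0, hb0]
      exact h
    obtain ⟨hfirst, hsecond⟩ := IsLocalMin.deriv_eq_zero_and_second_nonneg hd1 hd2 hm
    simp only [Function.comp, hφ0, hb0, add_zero, one_mul] at hfirst hsecond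
    set D := fderivWithin ℝ (fun z => fderivWithin ℝ u s z (EuclideanSpace.single i 1)) s x
          (EuclideanSpace.single i 1) with hD
    rw [← hg, ← hP] at hsecond
    rw [← hP] at hfirst
    change P⁻¹ * φ' 0 + v i / √B = 0 at hfirst
    change 0 ≤ -(-g / P * φ' 0) / P ^ 2 * φ' 0 + P⁻¹ * D +
      (√B - v i * (v i / √B)) / √B ^ 2 at hsecond
    have hG0 : 0 < √B := Real.sqrt_pos.2 hB0
    have hGB : √B ^ 2 = B := Real.sq_sqrt hB0.le
    have hAG : A ≤ √B := Real.le_sqrt_of_sq_le (by nlinarith [sq_nonneg ‖v‖])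
    set G := √B with hGdef
    have hder : φ' 0 = -(P * v i / G) := by
      field_simp at hfirst ⊢
      linarith
    rw [hder] at hsecond
    have e : P * (-(-g / P * -(P * v i / G)) / P ^ 2 * -(P * v i / G) + P⁻¹ * D +
      (G - v i * (v i / G)) / G ^ 2) = g / G ^ 2 * v i ^ 2 + D + P / G - P * v i ^ 2 / G ^ 3 := by
      field_simp
      ring
    have h1 := mul_nonneg hP0.le hsecond
    rw [e, hGB] at h1
    have h2 : P / G ≤ P / A := div_le_div_of_nonneg_left hP0.le hA hAG
    have h3 : 0 ≤ P * v i ^ 2 / G ^ 3 := by positivity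
    linarith
  have hsum := Finset.sum_nonneg fun i (_ : i ∈ Finset.univ) => key i
  rw [Finset.sum_add_distrib, Finset.sum_add_distrib, ← Finset.mul_sum] at hsum
  have hnorm : ∑ i, v i ^ 2 = ‖v‖ ^ 2 := (EuclideanSpace.real_norm_sq_eq v).symm
  rw [hnorm] at hsum
  simp only [Finset.sum_const, Finset.card_univ, Fintype.card_fin, nsmul_eq_mul] at hsum
  push_cast at hsum
  unfold lapW at hpde
  have : g * (‖v‖ ^ 2 / B) = g / B * ‖v‖ ^ 2 := by ring
  rw [this]
  linarith

theorem primeNorm_continuous {d : ℕ} : Continuous (primeNorm : Euc d → ℝ) := by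
  unfold primeNorm
  refine Real.continuous_sqrt.comp (continuous_finsetSum _ fun i _ => ?_)
  by_cases hi : i = 0
  · simpa [hi] using continuous_const
  · simp only [hi, if_false]
    fun_prop

theorem sq_primeNorm {d : ℕ} (x : Euc d) :
    primeNorm x ^ 2 = ∑ i, if i = 0 then 0 else (x i) ^ 2 := by
  refine Real.sq_sqrt (Finset.sum_nonneg fun i _ => ?_)
  split_ifs <;> positivity

theorem primeNorm_le_norm_sub_axis {d : ℕ} (x : Euc d) (Y : ℝ) :
    primeNorm x ≤ ‖x - EuclideanSpace.single 0 Y‖ := by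
  refine Real.sqrt_le_iff.2 ⟨norm_nonneg _, ?_⟩
  rw [EuclideanSpace.real_norm_sq_eq]
  refine Finset.sum_le_sum fun i _ => ?_
  by_cases hi : i = 0
  · rw [if_pos hi]; positivity
  · simp [hi]

theorem isOpen_funnel {d : ℕ} {h : ℝ → ℝ} (hh : Continuous h) : IsOpen (funnel d h) :=
  isOpen_lt primeNorm_continuous (hh.comp (by fun_prop))

theorem primeNorm_eq_of_mem_frontier {d : ℕ} {h : ℝ → ℝ} (hh : Continuous h) {x : Euc d}
    (hx : x ∈ frontier (funnel d h)) : primeNorm x = h (x 0) :=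
  frontier_lt_subset_eq primeNorm_continuous (hh.comp (by fun_prop)) hx

/-- `T(u) + √(A² + |· - y|²)` has no local minimum at a boundary point of a funnel where the
outward normal points away from the point `y` of the axis. -/
theorem not_isLocalMinOn_of_mem_frontier {d : ℕ} {h : ℝ → ℝ} (hh : Continuous h)
    (hmono : Monotone h) (hd : ∀ t, 0 ≤ deriv h t) {u : Euc d → ℝ} {x : Euc d}
    (hxf : x ∈ frontier (funnel d h)) (hpos : 0 < h (x 0))
    (hu : DifferentiableWithinAt ℝ u (closure (funnel d h)) x)
    (hneu : neumannLHS h u x = 0) {T : ℝ → ℝ} {T' : ℝ} (hT : HasDerivAt T T' (u x)) {A : ℝ}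
    (hA : 0 < A) {Y : ℝ} (hstar : 0 < h (x 0) - deriv h (x 0) * (x 0 - Y)) :
    ¬ IsLocalMinOn (fun z => T (u z) + √(A ^ 2 + ‖z - EuclideanSpace.single 0 Y‖ ^ 2))
      (closure (funnel d h)) x := by
  intro hmin
  set y : Euc d := EuclideanSpace.single 0 Y with hy
  set ρ := primeNorm x with hρ
  have hρh : ρ = h (x 0) := primeNorm_eq_of_mem_frontier hh hxf
  have hρ0 : 0 < ρ := hρh ▸ hpos
  set h' := deriv h (x 0) with hh'
  set n : Euc d := WithLp.toLp 2 fun i => if i = 0 then -h' else x i / ρ with hn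
  have hn0 : n 0 = -h' := by simp [hn]
  have hni {i : Fin (d + 1)} (hi : i ≠ 0) : n i = x i / ρ := by simp [hn, hi]
  have hexp : n = ∑ i, n i • (EuclideanSpace.single i 1 : Euc d) := by
    ext j
    simp [Finset.sum_apply, Pi.single_apply]
  set u' := fderivWithin ℝ u (closure (funnel d h)) x with hu'
  have hun : u' n = 0 := by
    rw [hexp, map_sum]
    simp only [map_smul, smul_eq_mul]
    unfold neumannLHS at hneu
    have hs : (√(1 + deriv h (x 0) ^ 2))⁻¹ ≠ 0 :=
      inv_ne_zero (Real.sqrt_pos.2 (by positivity)).ne'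
    have := (mul_eq_zero.1 hneu).resolve_left hs
    rw [← this, Fin.sum_univ_succ, Fin.sum_univ_succ, hn0]
    simp [hni]
    rfl
  have hinner : inner ℝ (x - y) n = h (x 0) - h' * (x 0 - Y) := by
    have h1 : inner ℝ (x - y) n = ∑ i, (x - y) i * n i := by
      simp [PiLp.inner_apply, mul_comm]
    have h2 := sq_primeNorm x
    rw [Fin.sum_univ_succ] at h2 h1
    simp only [if_true, zero_add, Fin.succ_ne_zero, if_false] at h2
    have h3 (i : Fin d) : (x - y) i.succ * n i.succ = x i.succ ^ 2 / ρ := by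
      rw [hni (Fin.succ_ne_zero i), hy]
      simp
      ring
    rw [h1, hn0, Finset.sum_congr rfl fun i _ => h3 i, ← Finset.sum_div, ← h2, ← hρ, sq,
      mul_div_assoc, div_self hρ0.ne', ← hρh, hy]
    simp
    ring
  have hcone : -(ρ • n) ∈ posTangentConeAt (closure (funnel d h)) x := by
    refine mem_posTangentConeAt_of_segment_subset ?_
    rw [segment_eq_image']
    rintro _ ⟨t, ⟨ht0, ht1⟩, rfl⟩
    rcases ht0.eq_or_lt with rfl | ht
    · simpa using frontier_subset_closure hxf
    refine subset_closure ?_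
    have e1 : x + t • (x + -(ρ • n) - x) = x - (t * ρ) • n := by
      rw [add_sub_cancel_left, smul_neg, smul_smul, sub_eq_add_neg]
    simp only [e1]
    have e2 : primeNorm (x - (t * ρ) • n) = (1 - t) * ρ := by
      have : primeNorm (x - (t * ρ) • n) ^ 2 = ((1 - t) * ρ) ^ 2 := by
        rw [sq_primeNorm, mul_pow, hρ, sq_primeNorm, Finset.mul_sum]
        refine Finset.sum_congr rfl fun i _ => ?_
        by_cases hi : i = 0
        · simp [hi]
        · simp only [hi, if_false, PiLp.sub_apply, PiLp.smul_apply, smul_eq_mul, hni hi]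
          rw [← hρ]
          field_simp
      exact (pow_left_inj₀ (Real.sqrt_nonneg _) (mul_nonneg (by linarith) hρ0.le) two_ne_zero).1
        this
    have e3 : (x - (t * ρ) • n) 0 = x 0 + t * ρ * h' := by
      simp [hn0]
    change primeNorm _ < h _
    rw [e2, e3]
    have h4 : h (x 0) ≤ h (x 0 + t * ρ * h') :=
      hmono (le_add_of_nonneg_right (mul_nonneg (by positivity) (hd _)))
    nlinarith
  set B := A ^ 2 + ‖x - y‖ ^ 2 with hB
  have hB0 : 0 < B := by positivity
  have hsq : HasFDerivAt (fun z : Euc d => A ^ 2 + ‖z - y‖ ^ 2)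
      (2 • (innerSL ℝ (x - y)).comp (ContinuousLinearMap.id ℝ (Euc d))) x :=
    (((hasFDerivAt_id x).sub_const y).norm_sq).const_add _
  have hG := (hsq.sqrt hB0.ne').hasFDerivWithinAt (s := closure (funnel d h))
  have hM := (hT.comp_hasFDerivWithinAt x hu.hasFDerivWithinAt).add hG
  have hnn := hmin.hasFDerivWithinAt_nonneg hM hcone
  simp only [add_apply, smul_apply, map_neg, map_smul,
    smul_eq_mul, ContinuousLinearMap.comp_apply, ContinuousLinearMap.id_apply,
    innerSL_apply_apply, hinner, ← hu', hun, nsmul_eq_mul] at hnn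
  have hG0 : 0 < √B := Real.sqrt_pos.2 hB0
  have : 0 < ρ * (1 / (2 * √B) * (2 * (h (x 0) - h' * (x 0 - Y)))) := by positivity
  rw [← hB] at hnn
  push_cast at hnn
  linarith

/-- A monotone profile makes the funnel stable under forward translation along its axis. -/
lemma add_single_mem_closure_funnel {d : ℕ} {h : ℝ → ℝ} (hmono : Monotone h) {τ : ℝ} (hτ : 0 ≤ τ)
    {z : Euc d} (hz : z ∈ closure (funnel d h)) :
    z + EuclideanSpace.single 0 τ ∈ closure (funnel d h) := by
  refine map_mem_closure (f := fun z : Euc d => z + EuclideanSpace.single 0 τ) (by fun_prop) hz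
    fun w hw => ?_
  have e1 : primeNorm (w + EuclideanSpace.single 0 τ) = primeNorm w := by
    unfold primeNorm
    congr 1
    refine Finset.sum_congr rfl fun i _ => ?_
    by_cases hi : i = 0 <;> simp [hi]
  have e2 : (w + EuclideanSpace.single 0 τ : Euc d) 0 = w 0 + τ := by simp
  change primeNorm _ < h _
  rw [e1, e2]
  exact lt_of_lt_of_le hw (hmono (le_add_of_nonneg_right hτ))

/-- The zeroth-order terms left at an interior minimum are negative: near the centre (`r ≤ K * A`)
because `F` is positive, far away because `r ^ 2 / (A ^ 2 + r ^ 2)` is close to `1`. -/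
lemma reaction_drift_neg {F D w η μ C K A r : ℝ} (hw0 : 0 < w) (hμ0 : 0 < μ) (hμη : μ ≤ η)
    (hA0 : 0 < A) (hK1 : 1 ≤ K) (hKη : 8 * C ≤ η * K) (hnear : r ≤ K * A → μ * w ≤ F)
    (hF : -(C * w) ≤ F) (hD : D ≤ μ / 8 * w) :
    (F - η * w) * (r ^ 2 / (A ^ 2 + r ^ 2)) - F + D < 0 := by
  have hη : 0 < η := hμ0.trans_le hμη
  set B := A ^ 2 + r ^ 2 with hB
  have hB0 : 0 < B := by positivity
  set b := r ^ 2 / B with hb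
  have hb0 : 0 ≤ b := by positivity
  have h1b : 1 - b = A ^ 2 / B := by rw [hb, hB]; field_simp; ring
  have h1b0 : 0 ≤ 1 - b := by rw [h1b]; positivity
  have hμw : 0 < μ * w := by positivity
  have h10 := mul_le_mul_of_nonneg_right hμη hw0.le
  rcases le_total r (K * A) with hr | hr
  · have h3 := mul_le_mul_of_nonneg_left (hnear hr) h1b0
    have h4 := mul_le_mul_of_nonneg_left h10 hb0
    linarith
  · have hBK : K * A ^ 2 + A ^ 2 ≤ B := by
      have h2 : (K * A) ^ 2 ≤ r ^ 2 := pow_le_pow_left₀ (by positivity) hr 2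
      have h3 : K * A ^ 2 ≤ (K * A) ^ 2 := by
        rw [mul_pow]
        exact mul_le_mul_of_nonneg_right (by nlinarith) (sq_nonneg A)
      linarith
    have hA2 : 0 < A ^ 2 := by positivity
    have h4 : 1 - b ≤ 1 / 2 := by
      rw [h1b, div_le_iff₀ hB0]
      nlinarith
    have h5 : (1 - b) * C ≤ η / 8 := by
      rw [h1b, div_mul_eq_mul_div, div_le_iff₀ hB0]
      have h6 := mul_le_mul_of_nonneg_right hKη hA2.le
      have h7 := mul_le_mul_of_nonneg_left hBK hη.le
      have h8 : 0 < η * A ^ 2 := by positivity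
      linarith
    have h6 : -((1 - b) * F) ≤ η / 8 * w := by
      have h7 := mul_le_mul_of_nonneg_left hF h1b0
      have h8 := mul_le_mul_of_nonneg_right h5 hw0.le
      linarith
    have h9 : 1 / 2 * (η * w) ≤ b * (η * w) :=
      mul_le_mul_of_nonneg_right (by linarith) (by positivity)
    have h11 : 0 < η * w := by positivity
    linarith

set_option maxHeartbeats 400000 in
/-- Lemma 3.3: if a stationary solution `0 < u_∞ ≤ 1` in a funnel-shaped
domain dominates the compactly supported ball subsolution `ψ(· - x₀)` on some closed ball
`B̄_{R₀}(x₀) ⊆ Ω̄`, then `u_∞ ≡ 1`. -/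
theorem statement11 (d : ℕ) (f h : ℝ → ℝ) (θ R α L : ℝ)
    (hf : Bistable f θ) (hΩ : IsFunnel d R α L h)
    (uinf : Euc d → ℝ)
    (hreg : ContDiffOn ℝ 2 uinf (closure (funnel d h)))
    (hrange : ∀ x ∈ closure (funnel d h), uinf x ∈ Ioc (0 : ℝ) 1)
    (hpde : ∀ x ∈ closure (funnel d h), lapW (closure (funnel d h)) uinf x + f (uinf x) = 0)
    (hneu : ∀ x ∈ frontier (funnel d h), neumannLHS h uinf x = 0)
    (R₀ : ℝ) (hR₀ : 0 < R₀) (ψ : Euc d → ℝ)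
    (hψreg : ContDiffOn ℝ 2 ψ (Metric.closedBall 0 R₀))
    (hψpde : ∀ x ∈ Metric.closedBall (0 : Euc d) R₀,
      lapW (Metric.closedBall 0 R₀) ψ x + f (ψ x) = 0)
    (hψrange : ∀ x ∈ Metric.closedBall (0 : Euc d) R₀, ψ x ∈ Ico (0 : ℝ) 1)
    (hψzero : ∀ x ∈ Metric.sphere (0 : Euc d) R₀, ψ x = 0)
    (hψradial : ∀ x ∈ Metric.closedBall (0 : Euc d) R₀, ∀ y ∈ Metric.closedBall (0 : Euc d) R₀,
      ‖x‖ = ‖y‖ → ψ x = ψ y)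
    (hψmono : ∀ x ∈ Metric.closedBall (0 : Euc d) R₀, ∀ y ∈ Metric.closedBall (0 : Euc d) R₀,
      ‖x‖ ≤ ‖y‖ → ψ y ≤ ψ x)
    (hψθ : θ < ψ 0)
    (x₀ : Euc d) (hx₀ : x₀ ∈ funnel d h)
    (hball : Metric.closedBall x₀ R₀ ⊆ closure (funnel d h))
    (hdom : ∀ x ∈ Metric.closedBall x₀ R₀, ψ (x - x₀) ≤ uinf x) :
    ∀ x ∈ closure (funnel d h), uinf x = 1 := by
  set Ω := funnel d h with hΩdef
  set S := closure Ω with hS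
  have hhc : Continuous h := hΩ.smooth.continuous
  have hmono : Monotone h :=
    monotone_of_deriv_nonneg (hΩ.smooth.differentiable (by norm_num)) hΩ.deriv_nonneg
  have hhpos (t : ℝ) : 0 < h t := by
    have h1 := hmono (min_le_left t 0)
    rw [hΩ.left _ (min_le_right t 0)] at h1
    exact hΩ.Rpos.trans_le h1
  have htan : 0 < Real.tan α := by
    have h1 : 0 ≤ Real.tan α := (hΩ.deriv_nonneg 0).trans (hΩ.deriv_le 0)
    refine lt_of_le_of_ne h1 fun h2 => ?_
    have h3 := hhpos (L * Real.cos α)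
    rw [hΩ.right _ le_rfl, ← h2, mul_zero] at h3
    exact lt_irrefl _ h3
  have h0mem : (0 : Euc d) ∈ Metric.closedBall (0 : Euc d) R₀ := Metric.mem_closedBall_self hR₀.le
  obtain ⟨C, hC1, hC⟩ := hf.exists_lipschitz
  obtain ⟨κ, hκ, hκlow⟩ := hf.exists_linear_lower hψθ (hψrange 0 h0mem).2.le
  obtain ⟨η, hη, T, p, hTp, hTtop⟩ := hf.exists_profile hC1 hC
  have hC0 : 0 < C := by linarith
  set μ := min κ η with hμ
  have hμ0 : 0 < μ := lt_min hκ hη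
  have hμκ : μ ≤ κ := min_le_left _ _
  have hμη : μ ≤ η := min_le_right _ _
  set K := 1 + 8 * C / η with hK
  have hK1 : 1 ≤ K := le_add_of_nonneg_right (by positivity)
  have hKη : 8 * C ≤ η * K := by
    have : η * K = η + 8 * C := by rw [hK]; field_simp
    linarith
  set A := 8 * C * (d + 1) / μ + 1 with hA
  have hA0 : 0 < A := by positivity
  have hAμ : 8 * (C * (d + 1)) ≤ μ * A := by
    have : μ * A = 8 * C * (d + 1) + μ := by rw [hA]; field_simp
    linarith
  set ρ := K * A + 2 * ‖x₀‖ with hρ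
  have hρ0 : 0 < ρ := by positivity
  set Y := |x₀ 0| + |L * Real.cos α| + (ρ + R₀) + (ρ + R₀ + 1) / Real.tan α with hY
  have hdivpos : 0 < (ρ + R₀ + 1) / Real.tan α := by positivity
  have hYx₀ : x₀ 0 ≤ Y := by
    linarith [le_abs_self (x₀ 0), abs_nonneg (L * Real.cos α)]
  have hY0 : 0 < Y := by positivity
  have hYL : L * Real.cos α ≤ Y := by
    linarith [le_abs_self (L * Real.cos α), abs_nonneg (x₀ 0)]
  set y : Euc d := EuclideanSpace.single 0 Y with hy
  have hbig : Metric.closedBall y (ρ + R₀) ⊆ Ω := by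
    intro x hx
    rw [Metric.mem_closedBall, dist_eq_norm] at hx
    have h1 : |x 0 - Y| ≤ ρ + R₀ := by
      have h2 : ‖(x - y) 0‖ ≤ ‖x - y‖ := PiLp.norm_apply_le _ _
      have h3 : (x - y) 0 = x 0 - Y := by simp [hy]
      rw [h3, Real.norm_eq_abs] at h2
      exact h2.trans hx
    have h2 : primeNorm x ≤ ρ + R₀ := (primeNorm_le_norm_sub_axis x Y).trans hx
    have h3 := neg_le_of_abs_le h1
    have h4 : L * Real.cos α ≤ x 0 := by
      linarith [le_abs_self (L * Real.cos α), abs_nonneg (x₀ 0)]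
    have h5 : (ρ + R₀ + 1) / Real.tan α ≤ x 0 := by
      linarith [abs_nonneg (L * Real.cos α), abs_nonneg (x₀ 0)]
    change primeNorm x < h (x 0)
    rw [hΩ.right _ h4]
    rw [div_le_iff₀ htan] at h5
    linarith
  set a : Euc d := x₀ + EuclideanSpace.single 0 (Y - x₀ 0) with ha
  have hdoma : ∀ x ∈ Metric.closedBall a R₀, ψ (x - a) ≤ uinf x := by
    refine ball_domination_segment hC hreg hrange hpde hR₀ hψreg hψpde hψrange hψzero ?_ hdom
    intro t ht x hx
    have e1 : x₀ + t • (a - x₀) = x₀ + EuclideanSpace.single 0 (t * (Y - x₀ 0)) := by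
      rw [ha, add_sub_cancel_left]
      congr 1
      ext j
      by_cases hj : j = 0 <;> simp [hj]
    set τ := t * (Y - x₀ 0) with hτ
    have hx' : x - EuclideanSpace.single 0 τ ∈ Metric.closedBall x₀ R₀ := by
      rw [e1, Metric.mem_closedBall, dist_eq_norm] at hx
      rw [Metric.mem_closedBall, dist_eq_norm]
      have e : x - EuclideanSpace.single 0 τ - x₀ = x - (x₀ + EuclideanSpace.single 0 τ) := by abel
      rwa [e]
    have hτ0 : 0 ≤ τ := mul_nonneg ht.1 (sub_nonneg.2 hYx₀)
    simpa using add_single_mem_closure_funnel hmono hτ0 (hball hx')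
  have hay : ‖a - y‖ ≤ ρ := by
    have e1 : a - y = x₀ - EuclideanSpace.single 0 (x₀ 0) := by
      ext j
      by_cases hj : j = 0 <;> simp [ha, hy, hj]
    have h1 : ‖x₀ 0‖ ≤ ‖x₀‖ := PiLp.norm_apply_le _ _
    have h2 := norm_sub_le x₀ (EuclideanSpace.single 0 (x₀ 0))
    rw [PiLp.norm_single] at h2
    have h3 : 0 ≤ K * A := by positivity
    rw [e1]
    linarith
  have hcenter : ∀ z, ‖z - y‖ ≤ ρ → ψ 0 ≤ uinf z := by
    intro z hz
    have h1 : ∀ x ∈ Metric.closedBall z R₀, ψ (x - z) ≤ uinf x := by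
      refine ball_domination_segment hC hreg hrange hpde hR₀ hψreg hψpde hψrange hψzero ?_ hdoma
      intro t ht
      refine Subset.trans (Metric.closedBall_subset_closedBall' ?_) (hbig.trans subset_closure)
      have h2 : a + t • (z - a) ∈ Metric.closedBall y ρ :=
        (convex_closedBall y ρ).add_smul_sub_mem (by simpa [dist_eq_norm] using hay)
          (by simpa [dist_eq_norm] using hz) ht
      rw [Metric.mem_closedBall] at h2
      linarith
    simpa using h1 z (Metric.mem_closedBall_self hR₀.le)
  intro xb hxb
  by_contra hne
  have hub : uinf xb ∈ Ioo (0 : ℝ) 1 := ⟨(hrange xb hxb).1, lt_of_le_of_ne (hrange xb hxb).2 hne⟩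
  set G : Euc d → ℝ := fun z => √(A ^ 2 + ‖z - y‖ ^ 2) with hG
  have hGc : Continuous G := by fun_prop
  have hGlt (z : Euc d) : ‖z - y‖ < G z := Real.lt_sqrt_of_sq_lt (by nlinarith [pow_pos hA0 2])
  set M := T (uinf xb) + G xb with hM
  obtain ⟨l, hl1, hl⟩ : ∃ l < (1 : ℝ), ∀ s ∈ Ioo l 1, M < T s := by
    have h1 := hTtop.eventually (eventually_gt_atTop M)
    obtain ⟨l, hl, hsub⟩ := (mem_nhdsLT_iff_exists_Ioo_subset).1 h1
    exact ⟨l, hl, fun s hs => hsub hs⟩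
  obtain ⟨l', hll', hl'1⟩ := exists_between hl1
  have hG0 (z : Euc d) : 0 ≤ G z := Real.sqrt_nonneg _
  have hsmall : ∀ z ∈ S, uinf z < 1 → T (uinf z) + G z ≤ M → uinf z < l' ∧ ‖z - y‖ < M := by
    intro z hz hz1 hzM
    have hz0 := (hrange z hz).1
    constructor
    · by_contra! h2
      have := hl (uinf z) ⟨hll'.trans_le h2, hz1⟩
      linarith [hG0 z]
    · linarith [(hTp _ ⟨hz0, hz1⟩).2.2.2.2, hGlt z]
  set Q : Set (Euc d) := (Metric.closedBall y M ∩ S) ∩ {z | z ∈ S ∧ uinf z ≤ l'} with hQ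
  have hQc : IsCompact Q := by
    have h1 : IsClosed (S ∩ uinf ⁻¹' Iic l') :=
      hreg.continuousOn.preimage_isClosed_of_isClosed isClosed_closure isClosed_Iic
    exact ((isCompact_closedBall y M).inter_right isClosed_closure).inter_right h1
  have hxbQ : xb ∈ Q := by
    obtain ⟨h1, h2⟩ := hsmall xb hxb hub.2 le_rfl
    exact ⟨⟨by simpa [dist_eq_norm] using h2.le, hxb⟩, hxb, h1.le⟩
  have hcont : ContinuousOn (fun z => T (uinf z) + G z) Q := by
    refine ContinuousOn.add ?_ hGc.continuousOn
    intro z hz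
    have h1 : uinf z ∈ Ioo (0 : ℝ) 1 := ⟨(hrange z hz.1.2).1, hz.2.2.trans_lt hl'1⟩
    exact ((hTp _ h1).2.2.1.continuousAt).comp_continuousWithinAt
      ((hreg.continuousOn z hz.1.2).mono fun w hw => hw.1.2)
  obtain ⟨x, hxQ, hxmin⟩ := hQc.exists_isMinOn ⟨xb, hxbQ⟩ hcont
  have hxS : x ∈ S := hxQ.1.2
  have hux : uinf x ∈ Ioo (0 : ℝ) 1 := ⟨(hrange x hxS).1, hxQ.2.2.trans_lt hl'1⟩
  have hxM : T (uinf x) + G x ≤ M := hxmin hxbQ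
  obtain ⟨hxl, hxy⟩ := hsmall x hxS hux.2 hxM
  have hloc : IsLocalMinOn (fun z => T (uinf z) + G z) S x := by
    have h1 : ∀ᶠ z in 𝓝[S] x, uinf z < l' :=
      (hreg.continuousOn x hxS).eventually (Iio_mem_nhds hxl)
    have h2 : ∀ᶠ z in 𝓝[S] x, ‖z - y‖ < M := by
      have hc : Continuous fun z : Euc d => ‖z - y‖ := by fun_prop
      exact (hc.continuousAt.eventually (Iio_mem_nhds hxy)).filter_mono nhdsWithin_le_nhds
    filter_upwards [h1, h2, self_mem_nhdsWithin] with z hz1 hz2 hzS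
    exact hxmin ⟨⟨by simpa [dist_eq_norm] using hz2.le, hzS⟩, hzS, hz1.le⟩
  obtain ⟨hp0, hple, hTd, hpd, -⟩ := hTp _ hux
  by_cases hxΩ : x ∈ Ω
  · have hnhds : S ∈ 𝓝 x := mem_of_superset ((isOpen_funnel hhc).mem_nhds hxΩ) subset_closure
    have hineq := laplacian_ineq_of_isLocalMin
      (fun s hs => ⟨(hTp s hs).1, (hTp s hs).2.2.1, (hTp s hs).2.2.2.1⟩)
      hreg hnhds hux (hpde x hxS) hA0 (hloc.isLocalMin hnhds)
    set w := 1 - uinf x with hw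
    have hw0 : 0 < w := sub_pos.2 hux.2
    have hdrift : (d + 1) * (p (uinf x) / A) ≤ μ / 8 * w := by
      have h1 : p (uinf x) / A ≤ C * w / A := div_le_div_of_nonneg_right hple hA0.le
      have h2 : C * (d + 1) / A ≤ μ / 8 := by
        rw [div_le_iff₀ hA0]; linarith
      calc (d + 1) * (p (uinf x) / A) ≤ (d + 1) * (C * w / A) :=
            mul_le_mul_of_nonneg_left h1 (by positivity)
        _ = C * (d + 1) / A * w := by ring
        _ ≤ _ := mul_le_mul_of_nonneg_right h2 hw0.le
    have hlip := hC _ ⟨hux.1.le, hux.2.le⟩ 1 (by simp)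
    rw [hf.f1, sub_zero, abs_sub_comm, abs_of_pos hw0] at hlip
    refine hineq.not_gt (reaction_drift_neg hw0 hμ0 hμη hA0 hK1 hKη ?_ (neg_le_of_abs_le hlip)
      hdrift)
    intro hr
    have h1 := hcenter x (by linarith [norm_nonneg x₀])
    exact (mul_le_mul_of_nonneg_right hμκ hw0.le).trans (hκlow _ ⟨h1, hux.2.le⟩)
  · have hxf : x ∈ frontier Ω := ⟨hxS, by rwa [(isOpen_funnel hhc).interior_eq]⟩
    refine not_isLocalMinOn_of_mem_frontier hhc hmono hΩ.deriv_nonneg hxf (hhpos _)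
      ((hreg x hxS).differentiableWithinAt (by norm_num)) (hneu x hxf) hTd hA0 (Y := Y) ?_ hloc
    have hd0 := hΩ.deriv_nonneg (x 0)
    rcases le_total (x 0) Y with h1 | h1
    · nlinarith [hhpos (x 0)]
    · rw [hΩ.right _ (hYL.trans h1)]
      have h2 := mul_le_mul_of_nonneg_right (hΩ.deriv_le (x 0)) (sub_nonneg.2 h1)
      nlinarith [mul_pos hY0 htan]
end
end
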